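/- arXiv:1310.7117 — 4 statements merged into one kernel-verified Lean document; each statement's English description precedes it below -/
import Mathlib

section
/- Let s = (i_r, …, i₂, i₁) be integers with i₁ > i₂ > ⋯ > i_r ≥ 2 satisfying condition C. Let ∼ be the smallest equivalence relation on [2i₁] invariant under all τ_{i_j}, i_j ∈ s. Then for every 1 ≤ t ≤ r, i_t is not equivalent to 2i_t, and the elements i₁, …, i_r are pairwise inequivalent. -/
/-- The involution `τ_i`. -/
def tauInv (i t : ℕ) : ℕ :=
  if 0 < t ∧ t < i then t + i
  else if i < t ∧ t < 2 * i then t - i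
  else t

open Polynomial

/-- The degree condition on the coefficients of a relation, together with condition C on the
exponents, for a list of pairs (exponent, coefficient). -/
def IsAdmissible : List (ℕ × ℚ[X]) → Prop
  | [] => True
  | a :: l => a.2.natDegree < a.1 ∧ (l.map Prod.fst).sum < a.1 ∧ IsAdmissible l

theorem X_pow_sub_one_mul_mem_degreeLT {n N : ℕ} {f : ℚ[X]} (h : n + f.natDegree < N) :
    (X ^ n - 1) * f ∈ degreeLT ℚ N := by
  rw [mem_degreeLT]
  refine lt_of_le_of_lt degree_le_natDegree ?_
  have h1 : ((X ^ n - 1 : ℚ[X]) * f).natDegree ≤ (X ^ n - 1 : ℚ[X]).natDegree + f.natDegree :=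
    natDegree_mul_le
  have h2 : (X ^ n - 1 : ℚ[X]).natDegree = n := by
    simpa using natDegree_X_pow_sub_C (n := n) (r := (1 : ℚ))
  exact_mod_cast (by omega : ((X ^ n - 1 : ℚ[X]) * f).natDegree < N)

theorem eq_zero_or_lt_of_X_pow_sub_one_mul_mem {n N : ℕ} (hn : 0 < n) {f : ℚ[X]}
    (h : (X ^ n - 1) * f ∈ degreeLT ℚ N) : f = 0 ∨ n + f.natDegree < N := by
  by_cases hf : f = 0
  · exact Or.inl hf
  right
  have h2 : (X ^ n - 1 : ℚ[X]).natDegree = n := by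
    simpa using natDegree_X_pow_sub_C (n := n) (r := (1 : ℚ))
  have h0 : (X ^ n - 1 : ℚ[X]) ≠ 0 := by
    intro h0
    rw [h0] at h2
    simp at h2
    omega
  rw [mem_degreeLT, degree_eq_natDegree (mul_ne_zero h0 hf), natDegree_mul h0 hf, h2] at h
  exact_mod_cast h

theorem IsAdmissible.natDegree_lt {P : List (ℕ × ℚ[X])} (hP : IsAdmissible P) :
    ∀ a ∈ P, a.2.natDegree < a.1 := by
  induction P with
  | nil => simp
  | cons q Q ih =>
    intro a ha
    rcases List.mem_cons.1 ha with rfl | ha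
    · exact hP.1
    · exact ih hP.2.2 a ha

theorem fst_le_sum_of_mem {P : List (ℕ × ℚ[X])} {a : ℕ × ℚ[X]} (ha : a ∈ P) :
    a.1 ≤ (P.map Prod.fst).sum :=
  List.single_le_sum (by simp) _ (List.mem_map_of_mem ha)

theorem sum_mem_degreeLT {L : List (ℕ × ℚ[X])} {N : ℕ}
    (h : ∀ a ∈ L, a.1 + a.2.natDegree < N) :
    (L.map fun a => (X ^ a.1 - 1) * a.2).sum ∈ degreeLT ℚ N := by
  refine list_sum_mem fun q hq => ?_
  obtain ⟨a, ha, rfl⟩ := List.mem_map.1 hq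
  exact X_pow_sub_one_mul_mem_degreeLT (h a ha)

theorem sum_X_pow_sub_one_mul_eq_sub (p : ℕ) {L : List (ℕ × ℚ[X])} (h : ∀ a ∈ L, p ≤ a.1) :
    (L.map fun a => (X ^ a.1 - 1) * a.2).sum =
      ((L.map fun a => (a.1 - p, a.2)).map fun a => (X ^ a.1 - 1) * a.2).sum +
        (X ^ p - 1) * (L.map fun a => X ^ (a.1 - p) * a.2).sum := by
  induction L with
  | nil => simp
  | cons a l ih =>
    have hp : (X : ℚ[X]) ^ a.1 = X ^ p * X ^ (a.1 - p) := by
      rw [← pow_add, Nat.add_sub_cancel' (h a (by simp))]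
    simp only [List.map_cons, List.sum_cons]
    rw [ih fun b hb => h b (List.mem_cons_of_mem _ hb), hp]
    ring

theorem eq_zero_of_sum_eq_zero (n : ℕ) : ∀ L P : List (ℕ × ℚ[X]),
    L.length + 2 * P.length ≤ n →
    L.Pairwise (fun a b => b.1 + b.2.natDegree < a.1) →
    (∀ a ∈ L, (P.map Prod.fst).sum < a.1) →
    IsAdmissible P →
    (L.map fun a => (X ^ a.1 - 1) * a.2).sum + (P.map fun a => (X ^ a.1 - 1) * a.2).sum = 0 →
    (∀ a ∈ L, a.2 = 0) ∧ ∀ a ∈ P, a.2 = 0 := by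
  induction n with
  | zero =>
    intro L P hn _ _ _ _
    have hL : L = [] := List.length_eq_zero_iff.1 (by omega)
    have hP : P = [] := List.length_eq_zero_iff.1 (by omega)
    simp [hL, hP]
  | succ n ih =>
    intro L P hn hL hLP hP hsum
    rcases L with _ | ⟨h, T⟩
    · rcases P with _ | ⟨q, Q⟩
      · simp
      · have := ih [q] Q (by simp at hn ⊢; omega) (by simp) (by simpa using hP.2.1) hP.2.2
          (by simpa using hsum)
        simpa using this
    have hh : 0 < h.1 := lt_of_le_of_lt (Nat.zero_le _) (hLP h (by simp))
    obtain ⟨hT, hTT⟩ := List.pairwise_cons.1 hL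
    have hhead : (X ^ h.1 - 1) * h.2 = -((T.map fun a => (X ^ a.1 - 1) * a.2).sum +
        (P.map fun a => (X ^ a.1 - 1) * a.2).sum) := by
      simp only [List.map_cons, List.sum_cons] at hsum
      linear_combination hsum
    have hbound : ∀ N, h.1 ≤ N → (∀ a ∈ P, a.1 + a.2.natDegree < N) →
        h.2 = 0 ∨ h.1 + h.2.natDegree < N := by
      intro N hN hPN
      apply eq_zero_or_lt_of_X_pow_sub_one_mul_mem hh
      rw [hhead]
      exact neg_mem (add_mem (sum_mem_degreeLT fun a ha => (hT a ha).trans_le hN)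
        (sum_mem_degreeLT hPN))
    by_cases hcase : ∀ a ∈ P, 2 * a.1 ≤ h.1
    · have h0 : h.2 = 0 := by
        rcases hbound h.1 le_rfl fun a ha => by
          have := hcase a ha
          have := hP.natDegree_lt a ha
          omega with h0 | h0
        · exact h0
        · omega
      have := ih T P (by simp at hn; omega) hTT
        (fun a ha => hLP a (List.mem_cons_of_mem _ ha)) hP (by simpa [h0] using hsum)
      exact ⟨by simpa [h0] using this.1, this.2⟩
    rcases P with _ | ⟨q, Q⟩
    · simp at hcase
    have hQ : ∀ a ∈ Q, a.1 < q.1 := fun a ha => (fst_le_sum_of_mem ha).trans_lt hP.2.1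
    have hq : h.1 < 2 * q.1 := by
      by_contra hq
      apply hcase
      intro a ha
      rcases List.mem_cons.1 ha with rfl | ha
      · omega
      · have := hQ a ha
        omega
    have hdeg : h.1 + h.2.natDegree < 2 * q.1 := by
      rcases hbound (2 * q.1) hq.le fun a ha => by
        have := hP.natDegree_lt a ha
        rcases List.mem_cons.1 ha with rfl | ha
        · omega
        · have := hQ a ha
          omega with h0 | h0
      · simpa [h0] using hq
      · exact h0
    have hlt : ∀ a ∈ h :: T, q.1 + (Q.map Prod.fst).sum < a.1 := by
      simpa only [List.map_cons, List.sum_cons] using hLP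
    have hrest := sum_X_pow_sub_one_mul_eq_sub q.1 (L := h :: T)
      fun a ha => by have := hlt a ha; omega
    have key := ih
      ((q.1, q.2 + ((h :: T).map fun a => X ^ (a.1 - q.1) * a.2).sum) ::
        (h :: T).map fun a => (a.1 - q.1, a.2)) Q
      (by simp at hn ⊢; omega)
      (by
        refine List.pairwise_cons.2 ⟨?_, ?_⟩
        · intro b hb
          obtain ⟨a, ha, rfl⟩ := List.mem_map.1 hb
          have := hlt a ha
          have : a.1 + a.2.natDegree < 2 * q.1 := by
            rcases List.mem_cons.1 ha with rfl | ha
            · exact hdeg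
            · exact (hT a ha).trans hq
          dsimp only
          omega
        · rw [List.pairwise_map]
          refine hL.imp_of_mem fun {a b} ha hb hab => ?_
          have := hlt a ha
          have := hlt b hb
          dsimp only
          omega)
      (by
        intro b hb
        rcases List.mem_cons.1 hb with rfl | hb
        · exact hP.2.1
        · obtain ⟨a, ha, rfl⟩ := List.mem_map.1 hb
          have := hlt a ha
          dsimp only
          omega)
      hP.2.2
      (by
        rw [hrest, List.map_cons (l := Q), List.sum_cons] at hsum
        rw [List.map_cons, List.sum_cons]
        linear_combination hsum)
    have hL0 : ∀ a ∈ h :: T, a.2 = 0 := fun a ha =>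
      key.1 (a.1 - q.1, a.2) (List.mem_cons_of_mem _ (List.mem_map.2 ⟨a, ha, rfl⟩))
    refine ⟨hL0, fun a ha => ?_⟩
    rcases List.mem_cons.1 ha with rfl | ha
    · have hz : ((h :: T).map fun b => X ^ (b.1 - a.1) * b.2).sum = 0 := by
        apply List.sum_eq_zero
        intro x hx
        obtain ⟨b, hb, rfl⟩ := List.mem_map.1 hx
        rw [hL0 b hb, mul_zero]
      have := key.1 _ List.mem_cons_self
      rw [hz, add_zero] at this
      exact this
    · exact key.2 a ha

theorem sum_map_range' {M : Type*} [AddCommMonoid M] (g : ℕ → M) (s n : ℕ) :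
    ((List.range' s n).map g).sum = ∑ j ∈ Finset.Ico s (s + n), g j := by
  induction n generalizing s with
  | zero => simp
  | succ n ih =>
    rw [List.range'_succ, List.map_cons, List.sum_cons, ih, show s + 1 + n = s + (n + 1) by omega,
      ← Finset.sum_eq_sum_Ico_succ_bot (by omega)]

theorem isAdmissible_map_range' (i : ℕ → ℕ) (f : ℕ → ℚ[X]) (s n : ℕ)
    (hf : ∀ j, s ≤ j → j < s + n → (f j).natDegree < i j)
    (hC : ∀ t, s ≤ t → t < s + n → ∑ j ∈ Finset.Ico (t + 1) (s + n), i j < i t) :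
    IsAdmissible ((List.range' s n).map fun j => (i j, f j)) := by
  induction n generalizing s with
  | zero => simp [IsAdmissible]
  | succ n ih =>
    have e : s + 1 + n = s + (n + 1) := by omega
    rw [List.range'_succ, List.map_cons]
    refine ⟨hf s le_rfl (by omega), ?_, ih (s + 1)
      (fun j h1 h2 => hf j (by omega) (by omega)) fun t h1 h2 => ?_⟩
    · rw [List.map_map, sum_map_range', e]
      exact hC s le_rfl (by omega)
    · rw [e]
      exact hC t (by omega) (by omega)

theorem coeff_eq_zero_of_sum_eq_zero {r : ℕ} {i : ℕ → ℕ}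
    (hpos : ∀ t, 1 ≤ t → t ≤ r → 0 < i t)
    (hC : ∀ t, 1 ≤ t → t ≤ r - 1 → ∑ j ∈ Finset.Icc (t + 1) r, i j < i t)
    {f : ℕ → ℚ[X]} (hf : ∀ j ∈ Finset.Icc 1 r, f j ∈ degreeLT ℚ (i j))
    (hsum : ∑ j ∈ Finset.Icc 1 r, (X ^ i j - 1) * f j = 0) :
    ∀ j ∈ Finset.Icc 1 r, f j = 0 := by
  have hIcc : ∀ s, Finset.Ico s (1 + r) = Finset.Icc s r := fun s => by
    ext; simp; omega
  have key := eq_zero_of_sum_eq_zero _ [] ((List.range' 1 r).map fun j => (i j, f j)) le_rfl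
    (by simp) (by simp)
    (isAdmissible_map_range' i f 1 r
      (fun j h1 h2 => by
        have := mem_degreeLT.1 (hf j (Finset.mem_Icc.2 ⟨h1, by omega⟩))
        by_cases h0 : f j = 0
        · simpa [h0] using hpos j h1 (by omega)
        · exact (natDegree_lt_iff_degree_lt h0).2 this)
      (fun t h1 h2 => by
        rw [hIcc]
        rcases eq_or_ne t r with rfl | hne
        · simpa using hpos t h1 le_rfl
        · exact hC t h1 (by omega)))
    (by
      rw [List.map_map, sum_map_range', hIcc]
      simpa using hsum)
  intro j hj
  rw [Finset.mem_Icc] at hj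
  exact key.2 (i j, f j) (List.mem_map.2 ⟨j, List.mem_range'_1.2 (by omega), rfl⟩)

theorem exists_sum_eq_of_eqvGen {r : ℕ} {i : ℕ → ℕ} {a b : ℕ}
    (h : Relation.EqvGen (fun a b => ∃ j, 1 ≤ j ∧ j ≤ r ∧ b = tauInv (i j) a) a b) :
    ∃ g : ℕ → ℚ[X], (∀ j, g j ∈ degreeLT ℚ (i j - 1)) ∧
      ∑ j ∈ Finset.Icc 1 r, (X ^ i j - 1) * (X * g j) = X ^ b - X ^ a := by
  have hsingle : ∀ j k, 1 ≤ j → j ≤ r → 0 < k → k < i j → ∀ c : ℚ[X], c = 1 ∨ c = -1 →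
      ∃ g : ℕ → ℚ[X], (∀ j, g j ∈ degreeLT ℚ (i j - 1)) ∧
        ∑ j ∈ Finset.Icc 1 r, (X ^ i j - 1) * (X * g j) = c * (X ^ (k + i j) - X ^ k) := by
    intro j k h1 h2 hk hkj c hc
    refine ⟨Pi.single j (c * X ^ (k - 1)), fun l => ?_, ?_⟩
    · rcases eq_or_ne l j with rfl | hl
      · have hX : (X : ℚ[X]) ^ (k - 1) ∈ degreeLT ℚ (i l - 1) := by
          rw [mem_degreeLT, degree_X_pow]
          exact_mod_cast (by omega : k - 1 < i l - 1)
        rw [Pi.single_eq_same]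
        rcases hc with rfl | rfl
        · simpa using hX
        · simpa using neg_mem hX
      · rw [Pi.single_eq_of_ne hl]
        exact zero_mem _
    · rw [Finset.sum_eq_single j]
      · obtain ⟨m, rfl⟩ : ∃ m, k = m + 1 := ⟨k - 1, by omega⟩
        rw [Pi.single_eq_same, Nat.add_sub_cancel]
        ring
      · intro l _ hl
        rw [Pi.single_eq_of_ne hl]
        simp
      · intro hj
        exact absurd (Finset.mem_Icc.2 ⟨h1, h2⟩) hj
  induction h with
  | rel a b hab =>
    obtain ⟨j, h1, h2, rfl⟩ := hab
    unfold tauInv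
    split_ifs with h h'
    · simpa using hsingle j a h1 h2 h.1 h.2 1 (Or.inl rfl)
    · obtain ⟨g, hg, hs⟩ := hsingle j (a - i j) h1 h2 (by omega) (by omega) (-1) (Or.inr rfl)
      refine ⟨g, hg, ?_⟩
      rw [hs, Nat.sub_add_cancel (by omega)]
      ring
    · exact ⟨0, fun _ => zero_mem _, by simp⟩
  | refl a => exact ⟨0, fun _ => zero_mem _, by simp⟩
  | symm a b _ ih =>
    obtain ⟨g, hg, hs⟩ := ih
    refine ⟨-g, fun j => neg_mem (hg j), ?_⟩
    simp only [Pi.neg_apply, mul_neg, Finset.sum_neg_distrib, hs]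
    ring
  | trans a b c _ _ ih₁ ih₂ =>
    obtain ⟨g, hg, hs⟩ := ih₁
    obtain ⟨g', hg', hs'⟩ := ih₂
    refine ⟨g + g', fun j => add_mem (hg j) (hg' j), ?_⟩
    simp only [Pi.add_apply, mul_add, Finset.sum_add_distrib, hs, hs']
    ring

theorem sum_X_pow_sub_one_mul_single {r t : ℕ} (i : ℕ → ℕ) (ht : t ∈ Finset.Icc 1 r)
    (q : ℚ[X]) :
    ∑ j ∈ Finset.Icc 1 r, (X ^ i j - 1) * (Pi.single t q : ℕ → ℚ[X]) j = (X ^ i t - 1) * q := by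
  rw [Finset.sum_eq_single_of_mem t ht fun j _ hj => by simp [Pi.single_eq_of_ne hj],
    Pi.single_eq_same]

theorem single_mem_degreeLT {i : ℕ → ℕ} {t : ℕ} {q : ℚ[X]} (hq : q ∈ degreeLT ℚ (i t)) (j : ℕ) :
    (Pi.single t q : ℕ → ℚ[X]) j ∈ degreeLT ℚ (i j) := by
  rcases eq_or_ne j t with rfl | hj
  · rwa [Pi.single_eq_same]
  · rw [Pi.single_eq_of_ne hj]
    exact zero_mem _

/-- For a sequence `i₁ > i₂ > ⋯ > i_r ≥ 2` satisfying condition C, in the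
smallest equivalence relation on `[2 i₁]` invariant under all `τ_{i_j}`, each
`i_t` is inequivalent to `2 i_t`, and the `i_t` are pairwise inequivalent. -/
theorem primary_difference_conditions (r : ℕ) (hr : 1 ≤ r) (i : ℕ → ℕ)
    (hge2 : ∀ t, 1 ≤ t → t ≤ r → 2 ≤ i t)
    (hdec : ∀ t, 1 ≤ t → t < r → i (t + 1) < i t)
    (hC : ∀ t, 1 ≤ t → t ≤ r - 1 → ∑ j ∈ Finset.Icc (t + 1) r, i j < i t) :
    (∀ t, 1 ≤ t → t ≤ r →
      ¬ Relation.EqvGen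
          (fun a b => ∃ j, 1 ≤ j ∧ j ≤ r ∧ b = tauInv (i j) a)
          (i t) (2 * i t)) ∧
    (∀ s t, 1 ≤ s → s ≤ r → 1 ≤ t → t ≤ r → s ≠ t →
      ¬ Relation.EqvGen
          (fun a b => ∃ j, 1 ≤ j ∧ j ≤ r ∧ b = tauInv (i j) a)
          (i s) (i t)) := by
  have hpos : ∀ t, 1 ≤ t → t ≤ r → 0 < i t := fun t h1 h2 => by
    have := hge2 t h1 h2
    omega
  constructor
  · intro t h1 h2 h
    have ht : t ∈ Finset.Icc 1 r := Finset.mem_Icc.2 ⟨h1, h2⟩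
    have hit := hge2 t h1 h2
    obtain ⟨g, hg, hs⟩ := exists_sum_eq_of_eqvGen h
    have hmem : (X : ℚ[X]) ^ (i t - 1) ∈ degreeLT ℚ (i t) := by
      rw [mem_degreeLT, degree_X_pow]
      exact_mod_cast (by omega : i t - 1 < i t)
    have h0 := coeff_eq_zero_of_sum_eq_zero hpos hC
      (f := g - Pi.single t (X ^ (i t - 1)))
      (fun j _ => sub_mem (degreeLT_mono (Nat.sub_le _ _) (hg j)) (single_mem_degreeLT hmem j))
      (by
        apply mul_left_cancel₀ (X_ne_zero (R := ℚ))
        simp only [Pi.sub_apply, mul_sub (X ^ i _ - 1 : ℚ[X]), Finset.sum_sub_distrib,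
          sum_X_pow_sub_one_mul_single i ht]
        rw [mul_sub, Finset.mul_sum]
        simp only [mul_left_comm X]
        rw [hs, ← pow_succ', Nat.sub_add_cancel (by omega)]
        ring) t ht
    have hc : (g t).coeff (i t - 1) = 0 :=
      coeff_eq_zero_of_degree_lt (mem_degreeLT.1 (hg t))
    have := congrArg (fun q => q.coeff (i t - 1)) h0
    simp [hc] at this
  · intro s t hs1 hs2 ht1 ht2 hst h
    have hs : s ∈ Finset.Icc 1 r := Finset.mem_Icc.2 ⟨hs1, hs2⟩
    have ht : t ∈ Finset.Icc 1 r := Finset.mem_Icc.2 ⟨ht1, ht2⟩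
    obtain ⟨g, hg, hsum⟩ := exists_sum_eq_of_eqvGen h
    have hone : ∀ u ∈ Finset.Icc 1 r, (1 : ℚ[X]) ∈ degreeLT ℚ (i u) := fun u hu => by
      rw [Finset.mem_Icc] at hu
      rw [mem_degreeLT, degree_one]
      exact_mod_cast hpos u hu.1 hu.2
    have h0 := coeff_eq_zero_of_sum_eq_zero hpos hC
      (f := fun j => X * g j - (Pi.single t 1 : ℕ → ℚ[X]) j + (Pi.single s 1 : ℕ → ℚ[X]) j)
      (fun j hj => by
        refine add_mem (sub_mem ?_ (single_mem_degreeLT (hone t ht) j))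
          (single_mem_degreeLT (hone s hs) j)
        rw [Finset.mem_Icc] at hj
        have := hpos j hj.1 hj.2
        have hgj := hg j
        rw [mem_degreeLT] at hgj ⊢
        by_cases hz : g j = 0
        · simp [hz]
        · rw [degree_eq_natDegree hz] at hgj
          have hlt : (g j).natDegree < i j - 1 := by exact_mod_cast hgj
          rw [degree_mul, degree_X, degree_eq_natDegree hz]
          exact_mod_cast (by omega : 1 + (g j).natDegree < i j))
      (by
        simp only [mul_add, mul_sub (X ^ i _ - 1 : ℚ[X]), Finset.sum_add_distrib,
          Finset.sum_sub_distrib, sum_X_pow_sub_one_mul_single i hs,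
          sum_X_pow_sub_one_mul_single i ht, hsum]
        ring) t ht
    have := congrArg (fun q => q.coeff 0) h0
    simp [Pi.single_eq_of_ne hst.symm] at this
end

section
/- Let s = (i_r, …, i₂, i₁) with i₁ > ⋯ > i_r ≥ 2 satisfying condition C, and let ∼ be the smallest equivalence relation on [2i₁] invariant under all τ_{i_j}. Then there exists 0 < x < 2i₁ with x ∼ x+1 if and only if i_s − i_{s+1} − i_{s+2} − ⋯ − i_t = 1 for some 1 ≤ s < t ≤ r. -/
/-- Every entry of the list exceeds the sum of the entries after it by at least `2`. -/
def GapTwo : List ℕ → Prop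
  | [] => True
  | n :: L => 2 + L.sum ≤ n ∧ GapTwo L

/-- On `(D, 2 * D)` the function `f` consists of runs `1, 2, 3, …` separated by zeros, the first run
starting at `D + 1` or later. -/
def IsRunWindow (D : ℕ) (f : ℕ → ℕ) : Prop :=
  f (D + 1) ≤ 1 ∧ ∀ u, D + 1 < u → u < 2 * D → f u = 0 ∨ f u = f (u - 1) + 1

/-- A colouring of `[1, D]` separating neighbours (cyclically) and invariant under the
identifications `t ∼ t + k` for `k ∈ L` and `1 ≤ t < k`, where a point `u > D` stands for `f u`,
and is unconstrained when `f u = 0`. -/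
structure SeparatingColoring (D : ℕ) (f : ℕ → ℕ) (L : List ℕ) (c : ℕ → ℕ) : Prop where
  le_self : ∀ v, 1 ≤ v → v ≤ D → c v ≤ v
  ne_succ : ∀ v, 1 ≤ v → v < D → c v ≠ c (v + 1)
  ne_last : c 1 ≠ c D
  inner : ∀ k ∈ L, ∀ t, 1 ≤ t → t < k → t + k ≤ D → c t = c (t + k)
  outer : ∀ k ∈ L, ∀ t, 1 ≤ t → t < k → D < t + k → f (t + k) ≠ 0 → c t = c (f (t + k))
  free_ne_one : ∀ u, D < u → u < 2 * L.headD 0 → f u = 0 → c (u - L.headD 0) ≠ c 1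
  free_ne_prev : ∀ u, D + 1 < u → u < 2 * L.headD 0 → f u = 0 → f (u - 1) ≠ 0 →
    c (u - L.headD 0) ≠ c (f (u - 1))
  free_ne_last : D + 1 < 2 * L.headD 0 → f (D + 1) = 0 → c (D + 1 - L.headD 0) ≠ c D

theorem IsRunWindow.le_sub {D : ℕ} {f : ℕ → ℕ} (hf : IsRunWindow D f) {u : ℕ} (hu : D < u)
    (hu' : u < 2 * D) : f u ≤ u - D := by
  induction u, Nat.succ_le_of_lt hu using Nat.le_induction with
  | base => have := hf.1; simp only [Nat.succ_eq_add_one]; omega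
  | succ u hle ih =>
    have h := hf.2 (u + 1) (by omega) hu'
    have := ih (by omega) (by omega)
    simp only [Nat.add_sub_cancel] at h
    omega

/-- The window obtained from `f` after the identifications `t ∼ t + n` are carried out. -/
def foldWindow (n : ℕ) (f : ℕ → ℕ) (v : ℕ) : ℕ :=
  if v < n then f (v + n) else if v < 2 * n then v - n else 0

/-- Extension of a colouring `c` of `[1, D]` along the pointers `g`; points with no pointer take
the colour of the point at distance `h` below, or a new colour. -/
def extendColoring (D h : ℕ) (c g : ℕ → ℕ) (v : ℕ) : ℕ :=
  if v ≤ D then c v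
  else if _ : 0 < g v ∧ g v < v then extendColoring D h c g (g v)
  else if v < 2 * h then c (v - h) else v
termination_by v

section extendColoring

variable {D h : ℕ} {c g : ℕ → ℕ} {v : ℕ}

theorem extendColoring_of_le (hv : v ≤ D) : extendColoring D h c g v = c v := by
  rw [extendColoring, if_pos hv]

theorem extendColoring_of_pointer (hv : D < v) (hg : g v ≠ 0) (hlt : g v < v) :
    extendColoring D h c g v = extendColoring D h c g (g v) := by
  rw [extendColoring, if_neg (by omega), dif_pos ⟨by omega, hlt⟩]

theorem extendColoring_of_attached (hv : D < v) (hg : g v = 0) (hlt : v < 2 * h) :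
    extendColoring D h c g v = c (v - h) := by
  rw [extendColoring, if_neg (by omega), dif_neg (by omega), if_pos hlt]

theorem extendColoring_of_new (hv : D < v) (hg : g v = 0) (hle : 2 * h ≤ v) :
    extendColoring D h c g v = v := by
  rw [extendColoring, if_neg (by omega), dif_neg (by omega), if_neg (by omega)]

end extendColoring

theorem GapTwo.two_mul_lt {D : ℕ} {L : List ℕ} (hL : GapTwo L) (hD : 2 + L.sum ≤ D) {k : ℕ}
    (hk : k ∈ L) : k + 2 ≤ D ∧ (k = L.headD 0 ∨ 2 * k < D) := by
  cases L with
  | nil => simp at hk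
  | cons n L =>
    simp only [List.sum_cons] at hD
    simp only [List.mem_cons, List.headD_cons] at hk ⊢
    rcases hk with rfl | hk
    · omega
    · have := List.le_sum_of_mem hk
      have := hL.1
      omega

theorem foldWindow_succ {D n : ℕ} {f : ℕ → ℕ} (hf : IsRunWindow D f) {v : ℕ}
    (hv : min n (D - n) < v) (hnD : n < D) :
    foldWindow n f (v + 1) = 0 ∨ foldWindow n f (v + 1) = foldWindow n f v + 1 := by
  unfold foldWindow
  by_cases h1 : v + 1 < n
  · have h := hf.2 (v + 1 + n) (by omega) (by omega)
    rw [show v + 1 + n - 1 = v + n by omega] at h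
    rwa [if_pos h1, if_pos (by omega)]
  · rw [if_neg h1]
    split_ifs <;> omega

theorem isRunWindow_foldWindow {D n : ℕ} {f : ℕ → ℕ} (hf : IsRunWindow D f)
    (hD : 2 + n ≤ D) : IsRunWindow (min n (D - n)) (foldWindow n f) := by
  refine ⟨?_, fun u hu _ => ?_⟩
  · unfold foldWindow
    split_ifs with h1 h2
    · rw [show min n (D - n) + 1 + n = D + 1 by omega]
      exact hf.1
    · omega
    · omega
  · have h := foldWindow_succ hf (v := u - 1) (n := n) (by omega) (by omega)
    rwa [show u - 1 + 1 = u by omega] at h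

theorem foldWindow_lt {D n : ℕ} {f : ℕ → ℕ} (hf : IsRunWindow D f) {v : ℕ}
    (hv : min n (D - n) < v) (hn : 2 ≤ n) (hnD : n < D) : foldWindow n f v < v := by
  unfold foldWindow
  split_ifs with h1 h2
  · have := hf.le_sub (u := v + n) (by omega) (by omega)
    omega
  · omega
  · omega

theorem SeparatingColoring.extend {D n : ℕ} {f c : ℕ → ℕ} {L : List ℕ} (hf : IsRunWindow D f)
    (hL : GapTwo (n :: L)) (hD : 2 + (n :: L).sum ≤ D)
    (hc : SeparatingColoring (min n (D - n)) (foldWindow n f) L c) :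
    SeparatingColoring D f (n :: L)
      (extendColoring (min n (D - n)) (L.headD 0) c (foldWindow n f)) := by
  have hn := hL.1
  simp only [List.sum_cons] at hD
  have gw := isRunWindow_foldWindow hf (n := n) (by omega)
  have gsucc := fun v hv => foldWindow_succ hf (n := n) (v := v) hv (by omega)
  have glt := fun v hv => foldWindow_lt hf (n := n) (v := v) hv (by omega) (by omega)
  have gsub : ∀ t, 1 ≤ t → t < n → foldWindow n f (t + n) = t := by
    intro t _ _
    unfold foldWindow
    rw [if_neg (by omega), if_pos (by omega), Nat.add_sub_cancel]
  have gadd : ∀ t, t < n → foldWindow n f t = f (t + n) := fun t ht => if_pos ht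
  have gbig : ∀ t, 2 * n ≤ t → foldWindow n f t = 0 := by
    intro t ht
    unfold foldWindow
    rw [if_neg (by omega), if_neg (by omega)]
  have hEn : min n (D - n) ≤ n := min_le_left _ _
  have hED : min n (D - n) + n ≤ D := by omega
  have hcase : min n (D - n) = n ∨ min n (D - n) + n = D := by omega
  have hE : 2 + L.sum ≤ min n (D - n) := by omega
  have hmem := fun k hk => hL.2.two_mul_lt hE (k := k) hk
  have hh : L.headD 0 + 2 ≤ min n (D - n) := by
    cases L with
    | nil => simp at hE ⊢; omega
    | cons k L => exact (hmem k (by simp)).1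
  have free_one := hc.free_ne_one
  have free_prev := hc.free_ne_prev
  have free_last := hc.free_ne_last
  generalize min n (D - n) = E at *
  generalize foldWindow n f = g at *
  generalize L.headD 0 = h at *
  have Cle : ∀ v, v ≤ E → extendColoring E h c g v = c v := fun v => extendColoring_of_le
  have Cpt : ∀ v, E < v → g v ≠ 0 → extendColoring E h c g v = extendColoring E h c g (g v) :=
    fun v hv hg => extendColoring_of_pointer hv hg (glt v hv)
  have Cat : ∀ v, E < v → g v = 0 → v < 2 * h → extendColoring E h c g v = c (v - h) :=
    fun v => extendColoring_of_attached
  have Cnew : ∀ v, E < v → g v = 0 → 2 * h ≤ v → extendColoring E h c g v = v :=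
    fun v => extendColoring_of_new
  generalize extendColoring E h c g = C at *
  have Cself : ∀ v, 1 ≤ v → C v ≤ v := by
    intro v
    induction v using Nat.strong_induction_on with
    | _ v ih =>
      intro hv
      by_cases h1 : v ≤ E
      · rw [Cle v h1]; exact hc.le_self v hv h1
      by_cases h2 : g v = 0
      · by_cases h3 : v < 2 * h
        · rw [Cat v (by omega) h2 h3]
          have := hc.le_self (v - h) (by omega) (by omega)
          omega
        · rw [Cnew v (by omega) h2 (by omega)]
      · rw [Cpt v (by omega) h2]
        have := glt v (by omega)
        have := ih (g v) this (by omega)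
        omega
  have star_one : ∀ v, E < v → g v = 0 → C v ≠ C 1 := by
    intro v hv hg
    by_cases h3 : v < 2 * h
    · rw [Cat v hv hg h3, Cle 1 (by omega)]
      exact free_one v hv h3 hg
    · rw [Cnew v hv hg (by omega)]
      have := Cself 1 le_rfl
      omega
  have star_last : g (E + 1) = 0 → C (E + 1) ≠ C E := by
    intro hg
    by_cases h3 : E + 1 < 2 * h
    · rw [Cat _ (by omega) hg h3, Cle E le_rfl]
      exact free_last h3 hg
    · rw [Cnew _ (by omega) hg (by omega)]
      have := Cself E (by omega)
      omega
  have star_prev : ∀ v, E < v → g (v + 1) = 0 → g v ≠ 0 → C (v + 1) ≠ C (g v) := by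
    intro v hv hg hg'
    by_cases h3 : v + 1 < 2 * h
    · have := gw.le_sub (u := v) hv (by omega)
      rw [Cat _ (by omega) hg h3, Cle (g v) (by omega)]
      exact free_prev (v + 1) (by omega) h3 hg hg'
    · rw [Cnew _ (by omega) hg (by omega)]
      have := Cself (g v) (by omega)
      have := glt v hv
      omega
  have Csucc : ∀ v, 1 ≤ v → C v ≠ C (v + 1) := by
    intro v
    induction v using Nat.strong_induction_on with
    | _ v ih =>
      intro hv
      by_cases h1 : v + 1 ≤ E
      · rw [Cle v (by omega), Cle (v + 1) h1]
        exact hc.ne_succ v hv (by omega)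
      by_cases h2 : v = E
      · subst h2
        by_cases hg : g (v + 1) = 0
        · exact (star_last hg).symm
        · have hg1 : g (v + 1) = 1 := by have := gw.1; omega
          rw [Cpt _ (by omega) hg, hg1, Cle 1 hv, Cle v le_rfl]
          exact hc.ne_last.symm
      have hEv : E < v := by omega
      by_cases hg : g (v + 1) = 0
      · by_cases hg' : g v = 0
        · by_cases h3 : v + 1 < 2 * h
          · rw [Cat _ (by omega) hg h3, Cat v hEv hg' (by omega),
              show v + 1 - h = v - h + 1 by omega]
            exact hc.ne_succ _ (by omega) (by omega)
          · rw [Cnew _ (by omega) hg (by omega)]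
            have := Cself v hv
            omega
        · rw [Cpt v hEv hg']
          exact (star_prev v hEv hg hg').symm
      · have hs : g (v + 1) = g v + 1 := (gsucc v hEv).resolve_left hg
        rw [Cpt (v + 1) (by omega) hg, hs]
        by_cases hg' : g v = 0
        · rw [hg']
          exact star_one v hEv hg'
        · rw [Cpt v hEv hg']
          exact ih (g v) (glt v hEv) (by omega)
  refine ⟨fun v hv _ => Cself v hv, fun v hv _ => Csucc v hv, ?_, ?_, ?_, ?_, ?_, ?_⟩
  · by_cases h2 : 2 * n ≤ D
    · exact (star_one D (by omega) (gbig D h2)).symm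
    · have hg : g D = E := by
        have := gsub E (by omega) (by omega)
        rwa [show E + n = D by omega] at this
      rw [Cpt D (by omega) (by omega), hg, Cle E le_rfl, Cle 1 (by omega)]
      exact hc.ne_last
  · intro k hk t ht htk hle
    rcases List.mem_cons.1 hk with rfl | hk
    · have hg := gsub t ht htk
      rw [Cpt (t + k) (by omega) (by omega), hg]
    · obtain ⟨hk1, hk2⟩ := hmem k hk
      rw [Cle t (by omega)]
      by_cases h1 : t + k ≤ E
      · rw [Cle _ h1]
        exact hc.inner k hk t ht htk h1
      by_cases hg : g (t + k) = 0
      · have hkh : k = h := by omega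
        rw [Cat _ (by omega) hg (by omega), hkh, Nat.add_sub_cancel]
      · have := gw.le_sub (u := t + k) (by omega) (by omega)
        rw [Cpt _ (by omega) hg, Cle _ (by omega)]
        exact hc.outer k hk t ht htk (by omega) hg
  · intro k hk t ht htk hlt hne
    rcases List.mem_cons.1 hk with rfl | hk
    · rw [← gadd t htk] at hne ⊢
      exact Cpt t (by omega) hne
    · have := hmem k hk
      omega
  · simp only [List.headD_cons]
    intro u hu hu' hfu
    have hg := gadd (u - n) (by omega)
    rw [Nat.sub_add_cancel (by omega)] at hg
    exact star_one _ (by omega) (by omega)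
  · simp only [List.headD_cons]
    intro u hu hu' hfu hfu'
    have hg := gadd (u - n) (by omega)
    have hg' := gadd (u - 1 - n) (by omega)
    rw [Nat.sub_add_cancel (by omega)] at hg hg'
    have hs := star_prev (u - 1 - n) (by omega)
    rw [show u - 1 - n + 1 = u - n by omega, hg, hg'] at hs
    exact hs hfu hfu'
  · simp only [List.headD_cons]
    intro hu hfu
    have hg := gadd (D + 1 - n) (by omega)
    rw [Nat.sub_add_cancel (by omega)] at hg
    have hE1 : D + 1 - n = E + 1 := by omega
    have hgD : g D = E := by
      have := gsub E (by omega) (by omega)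
      rwa [show E + n = D by omega] at this
    rw [Cpt D (by omega) (by omega), hgD, hE1]
    exact star_last (by rw [← hE1, hg, hfu])

theorem exists_separatingColoring (L : List ℕ) : ∀ (D : ℕ) (f : ℕ → ℕ), IsRunWindow D f →
    GapTwo L → 2 + L.sum ≤ D → ∃ c, SeparatingColoring D f L c := by
  induction L with
  | nil =>
    intro D f _ _ hD
    refine ⟨id, ?_, ?_, ?_, ?_, ?_, ?_, ?_, ?_⟩ <;> simp
    simp at hD
    omega
  | cons n L ih =>
    intro D f hf hL hD
    have hn := hL.1
    have hD' := hD
    simp only [List.sum_cons] at hD'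
    obtain ⟨c, hc⟩ := ih (min n (D - n)) (foldWindow n f)
      (isRunWindow_foldWindow hf (by omega)) hL.2 (by omega)
    exact ⟨_, hc.extend hf hL hD⟩

theorem exists_coloring_of_gapTwo {m : ℕ} {L : List ℕ} (hL : GapTwo (m :: L)) :
    ∃ C : ℕ → ℕ, (∀ x, 1 ≤ x → x < 2 * m → C x ≠ C (x + 1)) ∧
      ∀ k ∈ m :: L, ∀ t, 1 ≤ t → t < k → C t = C (t + k) := by
  have hm := hL.1
  obtain ⟨c, hc⟩ := exists_separatingColoring L m (fun u => u - m)
    ⟨by simp, fun u _ _ => by dsimp only; omega⟩ hL.2 hm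
  refine ⟨fun x => if x ≤ m then c x else if x < 2 * m then c (x - m) else x, ?_, ?_⟩
  · intro x hx hx'
    dsimp only
    rcases lt_trichotomy x m with h | rfl | h
    · rw [if_pos h.le, if_pos (Nat.succ_le_of_lt h)]
      exact hc.ne_succ x hx h
    · rw [if_pos le_rfl, if_neg (by omega), if_pos (by omega), Nat.add_sub_cancel_left]
      exact hc.ne_last.symm
    · rw [if_neg (by omega), if_pos hx', if_neg (by omega)]
      split_ifs with h1
      · rw [show x + 1 - m = x - m + 1 by omega]
        exact hc.ne_succ _ (by omega) (by omega)
      · have := hc.le_self (x - m) (by omega) (by omega)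
        omega
  · intro k hk t ht htk
    dsimp only
    rcases List.mem_cons.1 hk with rfl | hk
    · rw [if_pos htk.le, if_neg (by omega), if_pos (by omega), Nat.add_sub_cancel]
    · have := (hL.2.two_mul_lt hm hk).1
      rw [if_pos (by omega)]
      split_ifs with h1 h2
      · exact hc.inner k hk t ht htk h1
      · exact hc.outer k hk t ht htk (by omega) (by omega)
      · omega

theorem sum_map_range'_s13 (i : ℕ → ℕ) (l : ℕ) : ∀ a,
    ((List.range' a l).map i).sum = ∑ j ∈ Finset.Ico a (a + l), i j := by
  induction l with
  | zero => simp
  | succ l ih =>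
    intro a
    rw [List.range'_succ, List.map_cons, List.sum_cons, ih,
      Finset.sum_eq_sum_Ico_succ_bot (show a < a + (l + 1) by omega),
      show a + 1 + l = a + (l + 1) by omega]

theorem gapTwo_map_range' {i : ℕ → ℕ} (l : ℕ) : ∀ a,
    (∀ s, a ≤ s → s < a + l → 2 + ∑ j ∈ Finset.Ico (s + 1) (a + l), i j ≤ i s) →
    GapTwo ((List.range' a l).map i) := by
  induction l with
  | zero => intro a _; trivial
  | succ l ih =>
    intro a h
    have e : a + 1 + l = a + (l + 1) := by omega
    refine ⟨?_, ih (a + 1) fun s hs hs' => ?_⟩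
    · rw [sum_map_range'_s13, e]
      exact h a le_rfl (by omega)
    · rw [e]
      exact h s (by omega) (by omega)

theorem eq_of_eqvGen_tauInv {r : ℕ} {i C : ℕ → ℕ}
    (hC : ∀ j, 1 ≤ j → j ≤ r → ∀ t, 1 ≤ t → t < i j → C t = C (t + i j)) {x y : ℕ}
    (h : Relation.EqvGen (fun a b => ∃ j, 1 ≤ j ∧ j ≤ r ∧ b = tauInv (i j) a) x y) :
    C x = C y := by
  induction h with
  | rel a b hab =>
    obtain ⟨j, hj, hjr, rfl⟩ := hab
    unfold tauInv
    split_ifs with h1 h2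
    · exact hC j hj hjr a h1.1 h1.2
    · rw [hC j hj hjr (a - i j) (by omega) (by omega), Nat.sub_add_cancel h2.1.le]
    · rfl
  | refl => rfl
  | symm _ _ _ ih => exact ih.symm
  | trans _ _ _ _ _ ih₁ ih₂ => exact ih₁.trans ih₂

theorem eqvGen_one_sum {r : ℕ} {i : ℕ → ℕ} {s : ℕ} (hs : s ≤ r)
    (h : ∀ k, s < k → k ≤ r → 2 + ∑ j ∈ Finset.Icc (k + 1) r, i j ≤ i k) :
    Relation.EqvGen (fun a b => ∃ j, 1 ≤ j ∧ j ≤ r ∧ b = tauInv (i j) a)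
      (1 + ∑ j ∈ Finset.Icc (s + 1) r, i j) 1 := by
  induction hs using Nat.decreasingInduction with
  | self => simpa using Relation.EqvGen.refl 1
  | of_succ s hs ih =>
    have hk := h (s + 1) (by omega) hs
    have hsum : ∑ j ∈ Finset.Icc (s + 1) r, i j
        = i (s + 1) + ∑ j ∈ Finset.Icc (s + 1 + 1) r, i j := by
      rw [← Finset.add_sum_Ioc_eq_sum_Icc (by omega), Finset.Icc_add_one_left_eq_Ioc]
    refine .trans _ _ _ (.rel _ _ ⟨s + 1, by omega, hs, ?_⟩)
      (ih fun k hk hkr => h k (by omega) hkr)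
    rw [hsum, tauInv, if_neg (by omega), if_pos (by omega)]
    omega

/-- For `i₁ > ⋯ > i_r ≥ 2` satisfying condition C, there exist adjacent
equivalent elements `x ∼ x + 1` (for the smallest equivalence relation on
`[2 i₁]` invariant under all `τ_{i_j}`) iff
`i_s − i_{s+1} − ⋯ − i_t = 1` for some `1 ≤ s < t ≤ r`. -/
theorem adjacent_equivalent_iff (r : ℕ) (hr : 1 ≤ r) (i : ℕ → ℕ)
    (hge2 : ∀ t, 1 ≤ t → t ≤ r → 2 ≤ i t)
    (hdec : ∀ t, 1 ≤ t → t < r → i (t + 1) < i t)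
    (hC : ∀ t, 1 ≤ t → t ≤ r - 1 → ∑ j ∈ Finset.Icc (t + 1) r, i j < i t) :
    (∃ x, 1 ≤ x ∧ x < 2 * i 1 ∧
        Relation.EqvGen
          (fun a b => ∃ j, 1 ≤ j ∧ j ≤ r ∧ b = tauInv (i j) a)
          x (x + 1))
      ↔ (∃ s t, 1 ≤ s ∧ s < t ∧ t ≤ r ∧
          i s = (∑ j ∈ Finset.Icc (s + 1) t, i j) + 1) := by
  have hCr : ∀ t, 1 ≤ t → t ≤ r → ∑ j ∈ Finset.Icc (t + 1) r, i j < i t := by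
    intro t ht htr
    rcases htr.lt_or_eq with h | rfl
    · exact hC t ht (by omega)
    · have := hge2 t ht le_rfl
      simp
      omega
  constructor
  · rintro ⟨x, hx, hx', hxx⟩
    by_contra hne
    have hgap : ∀ s, 1 ≤ s → s < 1 + r → 2 + ∑ j ∈ Finset.Ico (s + 1) (1 + r), i j ≤ i s := by
      intro s hs hsr
      have e : Finset.Ico (s + 1) (1 + r) = Finset.Icc (s + 1) r := by
        ext j; simp only [Finset.mem_Ico, Finset.mem_Icc]; omega
      rw [e]
      rcases (Nat.lt_one_add_iff.1 hsr).lt_or_eq with h | rfl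
      · have h1 := hCr s hs h.le
        have h2 : i s ≠ ∑ j ∈ Finset.Icc (s + 1) r, i j + 1 :=
          fun h' => hne ⟨s, r, hs, h, le_rfl, h'⟩
        omega
      · simpa using hge2 s hs le_rfl
    obtain ⟨l, rfl⟩ := Nat.exists_eq_add_of_le' hr
    have hG := gapTwo_map_range' (l + 1) 1 hgap
    have hmem : ∀ j, 1 ≤ j → j ≤ l + 1 → i j ∈ (List.range' 1 (l + 1)).map i := fun j _ _ =>
      List.mem_map_of_mem (List.mem_range'_1.2 (by omega))
    rw [List.range'_succ, List.map_cons] at hG hmem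
    obtain ⟨C, hadj, hinv⟩ := exists_coloring_of_gapTwo hG
    exact hadj x hx hx' (eq_of_eqvGen_tauInv (fun j hj hjr => hinv _ (hmem j hj hjr)) hxx)
  · rintro ⟨s₀, t, hs₀, hst, htr, hsum₀⟩
    have hex : ∃ s, s < r ∧ 1 ≤ s ∧ i s = ∑ j ∈ Finset.Icc (s + 1) r, i j + 1 := by
      refine ⟨s₀, by omega, hs₀, ?_⟩
      have h1 := hCr s₀ hs₀ (by omega)
      have h2 : ∑ j ∈ Finset.Icc (s₀ + 1) t, i j ≤ ∑ j ∈ Finset.Icc (s₀ + 1) r, i j :=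
        Finset.sum_le_sum_of_subset (Finset.Icc_subset_Icc_right htr)
      omega
    classical
    obtain ⟨s, ⟨hsr, hs, hsum⟩, hmax⟩ : ∃ s,
        (s < r ∧ 1 ≤ s ∧ i s = ∑ j ∈ Finset.Icc (s + 1) r, i j + 1) ∧ ∀ k, s < k → k ≤ r →
          ¬(k < r ∧ 1 ≤ k ∧ i k = ∑ j ∈ Finset.Icc (k + 1) r, i j + 1) := by
      obtain ⟨s, hs⟩ := hex
      exact ⟨_, Nat.findGreatest_spec
        (P := fun s => s < r ∧ 1 ≤ s ∧ i s = ∑ j ∈ Finset.Icc (s + 1) r, i j + 1) hs.1.le hs,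
        fun k hk hkr => Nat.findGreatest_is_greatest hk hkr⟩
    have hgap : ∀ k, s < k → k ≤ r → 2 + ∑ j ∈ Finset.Icc (k + 1) r, i j ≤ i k := by
      intro k hk hkr
      have h1 := hCr k (by omega) hkr
      rcases hkr.lt_or_eq with h | rfl
      · have h2 : i k ≠ ∑ j ∈ Finset.Icc (k + 1) r, i j + 1 :=
          fun h' => hmax k hk hkr ⟨h, by omega, h'⟩
        omega
      · simpa using hge2 k (by omega) le_rfl
    have hle : i s ≤ i 1 := by
      clear hmax hgap hsum
      induction s, hs using Nat.le_induction with
      | base => exact le_rfl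
      | succ s hs ih => exact (hdec s hs (by omega)).le.trans (ih (by omega))
    have h2 := hge2 s hs hsr.le
    have hsum' : i s = 1 + ∑ j ∈ Finset.Icc (s + 1) r, i j := by omega
    refine ⟨i s, by omega, by omega, ?_⟩
    refine .trans _ 1 _ ?_ (.rel _ _ ⟨s, hs, hsr.le, ?_⟩)
    · rw [hsum']
      exact eqvGen_one_sum hsr.le hgap
    · rw [tauInv, if_pos (by omega)]
      omega
end

section
/- Let s = (i_r, …, i₂, i₁) be a strictly increasing sequence of positive integers with i₁ = i₂ + ⋯ + i_r and r ≥ 3. Then over any finite alphabet, every word w of length 2i₁ satisfying w_t = w_{t+i_j} for all 0 < t < i_j and all j contains a square vv with |v| ∈ {i₁,…,i_r}. (In the paper's terminology: minA(s) = ∞.) -/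
/-- The letters of `w` at positions `1, …, N - 1` have period `q`. -/
def HasPeriodBelow {A : Type*} (w : ℕ → A) (q N : ℕ) : Prop :=
  ∀ t, 0 < t → t + q < N → w t = w (t + q)

namespace HasPeriodBelow

variable {A : Type*} {w : ℕ → A}

theorem mono {q M N : ℕ} (h : HasPeriodBelow w q N) (hMN : M ≤ N) : HasPeriodBelow w q M :=
  fun t ht htq => h t ht (htq.trans_le hMN)

/-- A Euclidean descent in the style of Fine and Wilf: a period `g` which reaches `m + g`, and a
set `X` of periods with minimum `m`, each reaching `m + g` or a larger element of `X`. -/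
theorem exists_apply_eq (S : ℕ) : ∀ (g m : ℕ) (X : Finset ℕ), g + ∑ x ∈ X, x = S → 0 < g →
    0 < m → m ∈ X → (∀ x ∈ X, m ≤ x) → HasPeriodBelow w g (m + g) →
    (∀ x ∈ X, HasPeriodBelow w x (m + g) ∨ ∃ y ∈ X, x < y ∧ HasPeriodBelow w x y) →
    ∃ x ∈ X, w g = w x := by
  induction S using Nat.strong_induction_on with
  | _ S ih =>
  intro g m X hS hg hm hmX hmin hPg hX
  obtain ⟨M, hMX, hmax⟩ := X.exists_max_image id ⟨m, hmX⟩
  simp only [id] at hmax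
  have hPM : HasPeriodBelow w M (m + g) :=
    (hX M hMX).resolve_right fun ⟨y, hy, hlt, _⟩ => (hmax y hy).not_gt hlt
  have hsum : M + ∑ x ∈ X.erase M, x = ∑ x ∈ X, x := Finset.add_sum_erase X (fun x => x) hMX
  have hmM := hmax m hmX
  rcases le_or_gt (m + g) M with hMg | hMg
  · obtain ⟨x, hx, h⟩ := ih (g + ∑ x ∈ X.erase M, x) (by omega) g m (X.erase M) rfl hg hm
      (Finset.mem_erase.2 ⟨by omega, hmX⟩) (fun x hx => hmin x (Finset.mem_of_mem_erase hx)) hPg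
      (fun x hx => by
        rcases hX x (Finset.mem_of_mem_erase hx) with h | ⟨y, hy, hxy, h⟩
        · exact .inl h
        · by_cases hyM : y = M
          · exact .inl (h.mono (hyM ▸ hMg))
          · exact .inr ⟨y, Finset.mem_erase.2 ⟨hyM, hy⟩, hxy, h⟩)
    exact ⟨x, Finset.mem_of_mem_erase hx, h⟩
  rcases lt_trichotomy g M with hgM | rfl | hgM
  · obtain ⟨k, hk, rfl⟩ : ∃ k, 0 < k ∧ M = g + k := ⟨M - g, by omega, by omega⟩
    have hkX : k ∉ X.erase (g + k) := fun hc => by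
      have := hmin k (Finset.mem_of_mem_erase hc); omega
    have hPk : HasPeriodBelow w k m := fun t ht htk => by
      rw [hPM t ht (by omega), hPg (t + k) (by omega) (by omega)]
      congr 1; omega
    obtain ⟨x, hx, hgx⟩ := ih (g + ∑ x ∈ insert k (X.erase (g + k)), x)
      (by rw [Finset.sum_insert hkX]; omega) g k (insert k (X.erase (g + k))) rfl hg (by omega)
      (Finset.mem_insert_self _ _)
      (fun x hx => by
        rcases Finset.mem_insert.1 hx with hx | hx
        · exact hx.ge
        · have := hmin x (Finset.mem_of_mem_erase hx); omega)
      (hPg.mono (by omega))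
      (fun x hx => by
        rcases Finset.mem_insert.1 hx with hx | hx
        · rw [hx]
          by_cases hmM' : m = g + k
          · exact .inl (hPk.mono (by omega))
          · exact .inr ⟨m, Finset.mem_insert_of_mem (Finset.mem_erase.2 ⟨hmM', hmX⟩), by omega,
              hPk⟩
        · rcases hX x (Finset.mem_of_mem_erase hx) with h | ⟨y, hy, hxy, h⟩
          · exact .inl (h.mono (by omega))
          · by_cases hyM : y = g + k
            · exact .inl (h.mono (by omega))
            · exact .inr ⟨y, Finset.mem_insert_of_mem (Finset.mem_erase.2 ⟨hyM, hy⟩), hxy, h⟩)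
    rcases Finset.mem_insert.1 hx with hx | hx
    · refine ⟨g + k, hMX, ?_⟩
      rw [hgx, hx, hPg k (by omega) (by omega), add_comm]
    · exact ⟨x, Finset.mem_of_mem_erase hx, hgx⟩
  · exact ⟨g, hMX, rfl⟩
  · obtain ⟨k, rfl⟩ := Nat.exists_eq_add_of_le hgM.le
    obtain ⟨x, hx, h⟩ := ih (k + ∑ x ∈ X, x) (by omega) k m X rfl (by omega) hm hmX hmin
      (fun t ht htk => by
        rw [hPg t ht (by omega), hPM (t + k) (by omega) (by omega)]
        congr 1; omega)
      (fun x hx => (hX x hx).imp_left fun h => h.mono (by omega))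
    refine ⟨x, hx, ?_⟩
    rw [← h, hPM k (by omega) (by omega), add_comm]

theorem apply_eq_apply {g m : ℕ} (hg : 0 < g) (hm : 0 < m) (hPg : HasPeriodBelow w g (m + g))
    (hPm : HasPeriodBelow w m (m + g)) : w g = w m := by
  obtain ⟨x, hx, h⟩ := exists_apply_eq _ g m {m} rfl hg hm (by simp) (by simp) hPg (by simp [hPm])
  rwa [Finset.mem_singleton.1 hx] at h

end HasPeriodBelow

/-- If every `x ∈ T` is a period of `w₁ ⋯ w_{2x - 1}` exceeding the sum of the smaller elements of
`T` by at least `l`, then shifting by the sum of `T` fixes the first `l - 1` letters. -/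
theorem apply_sum_add {A : Type*} {w : ℕ → A} (T : Finset ℕ) {l : ℕ} :
    (∀ x ∈ T, HasPeriodBelow w x (2 * x)) → (∀ x ∈ T, ∑ y ∈ T with y < x, y + l ≤ x) →
    ∀ t, 0 < t → t < l → w (∑ x ∈ T, x + t) = w t := by
  induction T using Finset.induction_on_max with
  | empty => simp
  | insert b T hb ih =>
    intro hper hl t ht htl
    have hbT : b ∉ T := fun h => (hb b h).false
    have h1 : (insert b T).filter (· < b) = T := by
      ext y
      simp only [Finset.mem_filter, Finset.mem_insert]
      exact ⟨fun h => h.1.resolve_left h.2.ne, fun h => ⟨.inr h, hb y h⟩⟩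
    have h2 := hl b (Finset.mem_insert_self _ _)
    rw [h1] at h2
    have h3 := hper b (Finset.mem_insert_self _ _) (∑ x ∈ T, x + t) (by omega) (by omega)
    rw [Finset.sum_insert hbT, ← ih (fun x hx => hper x (Finset.mem_insert_of_mem hx))
      (fun x hx => ?_) t ht htl, h3]
    · congr 1; omega
    · have h4 := hl x (Finset.mem_insert_of_mem hx)
      rwa [Finset.filter_insert, if_neg (hb x hx).le.not_gt] at h4

theorem exists_strict_record {T : Finset ℕ} (d : ℕ → ℕ) {c : ℕ} (hc : ∃ x ∈ T, x < c) :
    ∃ y ∈ T, y < c ∧ (∀ x ∈ T, x < y → d y < d x) ∧ ∀ x ∈ T, x < c → d y ≤ d x := by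
  obtain ⟨x₀, hx₀, hx₀c⟩ := hc
  obtain ⟨y, hy, hmin⟩ := (T.filter (· < c)).exists_min_image (fun x => toLex (d x, x))
    ⟨x₀, Finset.mem_filter.2 ⟨hx₀, hx₀c⟩⟩
  rw [Finset.mem_filter] at hy
  have key : ∀ x ∈ T, x < c → d y < d x ∨ d y = d x ∧ y ≤ x := fun x hx hxc =>
    Prod.Lex.toLex_le_toLex.1 (hmin x (Finset.mem_filter.2 ⟨hx, hxc⟩))
  refine ⟨y, hy.1, hy.2, fun x hx hxy => ?_, fun x hx hxc => ?_⟩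
  · have := key x hx (by omega); omega
  · have := key x hx hxc; omega

/-- If `a` is at most the sum of a superdecreasing set `T` with at least three elements, but exceeds
the sum of every proper subset, then two of the letters at positions in `T ∪ {a}` agree, one
position being at least twice the other. -/
theorem exists_apply_eq_of_superdecreasing {A : Type*} {w : ℕ → A} {T : Finset ℕ} {a b y z : ℕ}
    (hperT : ∀ x ∈ T, HasPeriodBelow w x (2 * x)) (hpera : HasPeriodBelow w a (2 * a))
    (hsd : ∀ x ∈ T, ∑ u ∈ T with u < x, u < x) (hle : a ≤ ∑ x ∈ T, x)
    (hlt : ∑ x ∈ T.erase z, x < a) (hz : z ∈ T) (hy : y ∈ T) (hb : b ∈ T) (hzy : z < y)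
    (hyb : y < b) (hzmin : ∀ x ∈ T, z ≤ x) (hbmax : ∀ x ∈ T, x ≤ b) :
    ∃ p ∈ insert a T, ∃ q ∈ T, 2 * q ≤ p ∧ w p = w q := by
  obtain ⟨d, hd⟩ : ∃ d : ℕ → ℕ, ∀ x ∈ T, ∑ u ∈ T with u < x, u + d x = x ∧ 0 < d x :=
    ⟨fun x => x - ∑ u ∈ T with u < x, u, fun x hx => by have := hsd x hx; dsimp only; omega⟩
  have sum_lt : ∀ u ∈ T, ∀ x ∈ T, u < x → z < u → z + u < x := fun u hu x hx hux hzu => by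
    refine lt_of_le_of_lt ?_ (hsd x hx)
    rw [← Finset.sum_pair (f := fun v => v) hzu.ne]
    refine Finset.sum_le_sum_of_subset fun v hv => ?_
    simp only [Finset.mem_insert, Finset.mem_singleton] at hv
    rcases hv with rfl | rfl <;> simp [*]
    omega
  have two_mul_le : ∀ x ∈ T, x < b → 2 * x ≤ a := by
    have key : ∀ x ∈ T, z < x → x < b → x + b < a := fun x hx hzx hxb => by
      refine lt_of_le_of_lt ?_ hlt
      rw [← Finset.sum_pair (f := fun v => v) hxb.ne]
      refine Finset.sum_le_sum_of_subset fun v hv => ?_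
      simp only [Finset.mem_insert, Finset.mem_singleton] at hv
      rcases hv with rfl | rfl <;> simp [*] <;> omega
    intro x hx hxb
    rcases (hzmin x hx).eq_or_lt with rfl | hzx
    · have := key y hy hzy hyb; omega
    · have := key x hx hzx hxb; omega
  have hzb := sum_lt y hy b hb hyb hzy
  have hsum : z + ∑ x ∈ T.erase z, x = ∑ x ∈ T, x := Finset.add_sum_erase T (fun x => x) hz
  have hbS : b ≤ ∑ x ∈ T.erase z, x :=
    Finset.single_le_sum (f := fun x => x) (fun _ _ => Nat.zero_le _)
      (Finset.mem_erase.2 ⟨by omega, hb⟩)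
  have shift : ∀ x ∈ T, z < x → ∀ l, (∀ u ∈ T, u < x → l ≤ d u) →
      HasPeriodBelow w (d x) l ∧ (d x < l → w x = w (d x)) := fun x hx hzx l hl => by
    have h := apply_sum_add (w := w) (T.filter (· < x)) (l := l)
      (fun u hu => hperT u (Finset.mem_filter.1 hu).1) (fun u hu => by
        rw [Finset.mem_filter] at hu
        have h1 : (T.filter (· < x)).filter (· < u) = T.filter (· < u) := by
          ext v; simp only [Finset.mem_filter]; constructor
          · exact fun h => ⟨h.1.1, h.2⟩
          · exact fun h => ⟨⟨h.1, h.2.trans hu.2⟩, h.2⟩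
        rw [h1]
        have := hl u hu.1 hu.2; have := hd u hu.1; omega)
    have hdx := hd x hx
    have := hl z hz hzx
    have := hd z hz
    refine ⟨fun t ht htl => ?_, fun hlt => ?_⟩
    · rw [← h (t + d x) (by omega) htl, hperT x hx t ht (by omega)]
      congr 1; omega
    · rw [← h _ hdx.2 hlt, hdx.1]
  have hdz : d z = z := by
    have := hd z hz
    rw [Finset.filter_false_of_mem fun x hx => (hzmin x hx).not_gt] at this
    simpa using this.1
  obtain ⟨ρ, hρT, hρb, hρrec, hρmin⟩ := exists_strict_record d ⟨y, hy, hyb⟩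
  obtain ⟨m, hm, hmT, hmdef⟩ : ∃ m, 0 < m ∧ (∀ x ∈ T, m ≤ d x) ∧ (m = d b ∨ d ρ ≤ m) := by
    refine ⟨min (d b) (d ρ), ?_, fun x hx => ?_, by omega⟩
    · have := hd b hb; have := hd ρ hρT; omega
    · rcases (hbmax x hx).eq_or_lt with rfl | h
      · omega
      · have := hρmin x hx h; omega
  have shiftS : ∀ t, 0 < t → t < z + m → w (∑ x ∈ T.erase z, x + t) = w t :=
    apply_sum_add _ (fun u hu => hperT u (Finset.mem_of_mem_erase hu)) fun x hx => by
      rw [Finset.mem_erase] at hx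
      rw [Finset.filter_erase]
      have h1 : z ∈ T.filter (· < x) :=
        Finset.mem_filter.2 ⟨hz, (hzmin x hx.2).lt_of_ne hx.1.symm⟩
      have := Finset.add_sum_erase _ (fun x => x) h1
      have := hd x hx.2
      have := hmT x hx.2
      omega
  have shiftT : ∀ t, 0 < t → t < m → w (∑ x ∈ T, x + t) = w t :=
    apply_sum_add _ hperT fun x hx => by
      have := hd x hx; have := hmT x hx; omega
  have hzmb : z + m ≤ b := by
    have := hmT z hz
    omega
  by_contra! hno
  have hna : ∀ x ∈ T, x < b → w a ≠ w x := fun x hx hxb =>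
    hno a (Finset.mem_insert_self _ _) x hx (two_mul_le x hx hxb)
  obtain ⟨f, hf, haf⟩ : ∃ f, 0 < f ∧ a = ∑ x ∈ T.erase z, x + f :=
    ⟨a - ∑ x ∈ T.erase z, x, by omega, by omega⟩
  obtain ⟨g, hag⟩ : ∃ g, ∑ x ∈ T, x = a + g := ⟨_, (Nat.add_sub_cancel' hle).symm⟩
  have hfg : f + g = z := by omega
  have hwa : w a = w f := haf ▸ shiftS f hf (by omega)
  have hPf : HasPeriodBelow w f (z + m) := fun t ht htf => by
    rw [← shiftS (t + f) (by omega) htf, hpera t ht (by omega), haf]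
    congr 1; omega
  have hPg : HasPeriodBelow w g (m + g) := fun t ht htg => by
    rw [← shiftT t ht (by omega), hag, hpera (t + g) (by omega) (by omega)]
    congr 1; omega
  have hg : 0 < g := by
    rcases Nat.eq_zero_or_pos g with rfl | h
    · exact absurd (hfg ▸ hwa) (hna z hz (by omega))
    · exact h
  have hwz : w z = w g := by
    rw [hPf g hg (by omega)]
    congr 1; omega
  have hdρ := hd ρ hρT
  -- `ρ` is the last record below `b`; the period `g` reaches it.
  have hPgρ : HasPeriodBelow w g (d ρ) := by
    rcases le_or_gt (d ρ) (m + g) with h | h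
    · exact hPg.mono h
    · have hmb : m = d b := hmdef.resolve_right (by omega)
      obtain ⟨hPb, hwb⟩ := shift b hb (by omega) (d ρ) hρmin
      have := HasPeriodBelow.apply_eq_apply hg hm hPg (hmb ▸ hPb.mono (by omega))
      exact absurd (by rw [hwz, this, hwb (by omega), hmb])
        (hno b (Finset.mem_insert_of_mem hb) z hz (by omega)).symm
  let U : Finset ℕ := T.filter fun x => z < x ∧ x < b ∧ ∀ u ∈ T, u < x → d x < d u
  have hU : ∀ x ∈ U, x ∈ T ∧ z < x ∧ x < b ∧ ∀ u ∈ T, u < x → d x < d u := fun x hx =>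
    Finset.mem_filter.1 hx
  have hUz : ∀ x ∈ U, d x < z := fun x hx => by
    obtain ⟨_, hzx, _, h⟩ := hU x hx
    exact hdz ▸ h z hz hzx
  have hUwa : ∀ x ∈ U, w f ≠ w (d x) := fun x hx => by
    obtain ⟨hxT, hzx, hxb, h⟩ := hU x hx
    obtain ⟨u, hu, hux, -, humin⟩ := exists_strict_record d ⟨z, hz, hzx⟩
    rw [← hwa, ← (shift x hxT hzx (d u) humin).2 (h u hu hux)]
    exact hna x hxT hxb
  have hUρ : ∀ x ∈ U, d ρ ≤ d x := fun x hx => hρmin x (hU x hx).1 (hU x hx).2.2.1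
  have hUP : ∀ x ∈ U, HasPeriodBelow w (d x) z ∨
      ∃ u ∈ U, d x < d u ∧ HasPeriodBelow w (d x) (d u) := fun x hx => by
    obtain ⟨hxT, hzx, hxb, h⟩ := hU x hx
    obtain ⟨u, hu, hux, hurec, humin⟩ := exists_strict_record d ⟨z, hz, hzx⟩
    have hP := (shift x hxT hzx (d u) humin).1
    rcases (hzmin u hu).eq_or_lt with rfl | hzu
    · exact .inl (hdz ▸ hP)
    · exact .inr ⟨u, Finset.mem_filter.2 ⟨hu, hzu, by omega, hurec⟩, h u hu hux, hP⟩
  have hρU : z = ρ ∨ ρ ∈ U := (hzmin ρ hρT).eq_or_lt.imp_right fun h =>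
    Finset.mem_filter.2 ⟨hρT, h, hρb, hρrec⟩
  have hmρ : m ≤ d ρ := hmT ρ hρT
  rcases le_or_gt (d ρ) g with hρg | hρg
  · have hρU : ρ ∈ U := hρU.resolve_left (by rintro rfl; omega)
    obtain ⟨v, hv, hfv⟩ := HasPeriodBelow.exists_apply_eq (w := w) _ f (d ρ) (U.image d) rfl hf
      hdρ.2 (Finset.mem_image_of_mem d hρU) (by simpa using hUρ) (hPf.mono (by omega))
      (by
        simp only [Finset.mem_image, forall_exists_index, and_imp, forall_apply_eq_imp_iff₂,
          exists_exists_and_eq_and]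
        exact fun x hx => (hUP x hx).imp_left fun h => h.mono (by omega))
    obtain ⟨x, hx, rfl⟩ := Finset.mem_image.1 hv
    exact hUwa x hx hfv
  · obtain ⟨v, hv, hfv⟩ := HasPeriodBelow.exists_apply_eq (w := w) _ f g
      (insert g (U.image d)) rfl hf hg (Finset.mem_insert_self _ _)
      (by simpa using fun x hx => hρg.le.trans (hUρ x hx)) (hPf.mono (by omega))
      (by
        simp only [Finset.mem_insert, Finset.mem_image, forall_eq_or_imp, forall_exists_index,
          and_imp, forall_apply_eq_imp_iff₂, exists_eq_or_imp, exists_exists_and_eq_and]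
        refine ⟨?_, fun x hx => (hUP x hx).imp (fun h => h.mono (by omega)) .inr⟩
        rcases hρU with rfl | hρU
        · exact .inl (hPgρ.mono (by omega))
        · exact .inr (.inr ⟨ρ, hρU, hρg, hPgρ⟩))
    rcases Finset.mem_insert.1 hv with rfl | hv
    · exact hna z hz (by omega) (by rw [hwa, hfv, hwz])
    · obtain ⟨x, hx, rfl⟩ := Finset.mem_image.1 hv
      exact hUwa x hx hfv

/-- The case of two elements: `a ≤ b + z` with `z < b < a`. -/
theorem apply_eq_of_le_add {A : Type*} {w : ℕ → A} {a b z : ℕ}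
    (hPz : HasPeriodBelow w z (2 * z)) (hPb : HasPeriodBelow w b (2 * b))
    (hPa : HasPeriodBelow w a (2 * a)) (hz : 0 < z) (hzb : z < b) (hba : b < a)
    (hle : a ≤ b + z) :
    2 * z ≤ a ∧ w a = w z ∨ w b = w (2 * b) ∨ w z = w (2 * z) := by
  obtain ⟨f, hf, rfl⟩ : ∃ f, 0 < f ∧ a = b + f := ⟨a - b, by omega, by omega⟩
  obtain ⟨e, he, rfl⟩ : ∃ e, 0 < e ∧ b = z + e := ⟨b - z, by omega, by omega⟩
  obtain ⟨g, rfl⟩ : ∃ g, z = f + g := ⟨z - f, by omega⟩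
  have hwa : w (f + g + e + f) = w f := by
    rw [hPb f hf (by omega), add_comm]
  rcases Nat.eq_zero_or_pos g with rfl | hg
  · exact .inl ⟨by omega, hwa⟩
  have hPf : HasPeriodBelow w f (f + g + e) := fun t ht htf => by
    rw [hPa t ht (by omega), hPb (t + f) (by omega) (by omega)]
    congr 1; omega
  have hwz : w (f + g) = w g := by rw [hPf g hg (by omega), add_comm]
  have hPg : HasPeriodBelow w g (min (f + g) e + g) := fun t ht htg => by
    rw [hPz t ht (by omega), hPb (t + (f + g)) (by omega) (by omega),
      hPa (t + g) (by omega) (by omega)]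
    congr 1; omega
  rcases le_or_gt (f + g) e with hze | hez
  · refine .inl ⟨by omega, ?_⟩
    rw [hwa, hwz]
    exact HasPeriodBelow.apply_eq_apply hf hg (hPf.mono (by omega)) (hPg.mono (by omega))
  rw [min_eq_right hez.le] at hPg
  have hwb : w (f + g + e) = w e := by rw [hPz e he (by omega), add_comm]
  have hw2b : w (2 * (f + g + e)) = w (e + g) := by
    rw [hPa (e + g) (by omega) (by omega)]
    congr 1; omega
  rw [hw2b, hwb]
  right
  rcases lt_trichotomy f e with hfe | rfl | hef
  · left
    obtain ⟨k, hk, rfl⟩ : ∃ k, 0 < k ∧ e = k + f := ⟨e - f, by omega, by omega⟩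
    rw [← hPf k hk (by omega), hPg k hk (by omega), hPf (k + g) (by omega) (by omega)]
    congr 1; omega
  · right
    rw [hwz, hPb g hg (by omega)]
    congr 1; omega
  · left
    have hPe : HasPeriodBelow w e (f + g) := fun t ht hte => by
      rw [hPb t ht (by omega), hPz (t + e) (by omega) (by omega)]
      congr 1; omega
    rw [← HasPeriodBelow.apply_eq_apply hg he hPg (hPe.mono (by omega)),
      hPe g hg (by omega), add_comm]

theorem exists_apply_eq_of_le_sum {A : Type*} {w : ℕ → A} {Q : Finset ℕ}
    (hpos : ∀ q ∈ Q, 0 < q) (hper : ∀ q ∈ Q, HasPeriodBelow w q (2 * q))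
    (hQ : ∃ a ∈ Q, ∃ T ⊆ Q, (∀ x ∈ T, x < a) ∧ a ≤ ∑ x ∈ T, x) :
    ∃ p ∈ Q, ∃ q ∈ Q, 2 * q ≤ p ∧ w p = w q ∨ q < p ∧ w q = w (2 * q) := by
  classical
  obtain ⟨haQ, hT⟩ := Nat.find_spec hQ
  have hamin := fun x => Nat.find_min hQ (m := x)
  generalize Nat.find hQ = a at haQ hT hamin
  obtain ⟨T, hT, hTmin⟩ := (Q.powerset.filter fun T => (∀ x ∈ T, x < a) ∧ a ≤ ∑ x ∈ T, x)
    |>.exists_min_image Finset.card (hT.imp fun T h => by simpa using h)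
  simp only [Finset.mem_filter, Finset.mem_powerset] at hT hTmin
  obtain ⟨hTQ, hTa, hle⟩ := hT
  have hlt : ∀ z ∈ T, ∑ x ∈ T.erase z, x < a := fun z hz => by
    by_contra! h
    exact (hTmin _ ⟨(Finset.erase_subset _ _).trans hTQ,
      fun x hx => hTa x (Finset.mem_of_mem_erase hx), h⟩).not_gt (Finset.card_erase_lt_of_mem hz)
  have hsd : ∀ x ∈ T, ∑ u ∈ T with u < x, u < x := fun x hx => by
    by_contra! h
    exact hamin x (hTa x hx) ⟨hTQ hx, _, (Finset.filter_subset _ _).trans hTQ,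
      fun u hu => (Finset.mem_filter.1 hu).2, h⟩
  have hne : T.Nonempty := by
    rw [Finset.nonempty_iff_ne_empty]
    rintro rfl
    exact (hpos a haQ).not_ge hle
  obtain ⟨z, hz, hzmin⟩ := T.exists_min_image id hne
  obtain ⟨b, hb, hbmax⟩ := T.exists_max_image id hne
  simp only [id] at hzmin hbmax
  have hperT : ∀ x ∈ T, HasPeriodBelow w x (2 * x) := fun x hx => hper x (hTQ hx)
  by_cases hy : ∃ y ∈ T, z < y ∧ y < b
  · obtain ⟨y, hy, hzy, hyb⟩ := hy
    obtain ⟨p, hp, q, hq, h⟩ := exists_apply_eq_of_superdecreasing hperT (hper a haQ) hsd hle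
      (hlt z hz) hz hy hb hzy hyb hzmin hbmax
    exact ⟨p, Finset.insert_subset haQ hTQ hp, q, hTQ hq, .inl h⟩
  have hsub : T ⊆ {b, z} := fun x hx => by
    have := hzmin x hx
    have := hbmax x hx
    have : ¬(z < x ∧ x < b) := fun h => hy ⟨x, hx, h⟩
    simp only [Finset.mem_insert, Finset.mem_singleton]
    omega
  have hzb : z ≠ b := by
    rintro rfl
    have := hle.trans (Finset.sum_le_sum_of_subset hsub)
    have := hTa z hz
    simp at *
    omega
  have hbz : a ≤ b + z := by
    rw [← Finset.sum_pair (f := fun x => x) hzb.symm]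
    exact hle.trans (Finset.sum_le_sum_of_subset hsub)
  have hzb := (hzmin b hb).lt_of_ne hzb
  rcases apply_eq_of_le_add (hperT z hz) (hperT b hb) (hper a haQ) (hpos z (hTQ hz)) hzb
    (hTa b hb) hbz with h | h | h
  · exact ⟨a, haQ, z, hTQ hz, .inl h⟩
  · exact ⟨a, haQ, b, hTQ hb, .inr ⟨hTa b hb, h⟩⟩
  · exact ⟨b, hTQ hb, z, hTQ hz, .inr ⟨hzb, h⟩⟩

/-- If `i₁ > i₂ > ⋯ > i_r ≥ 1`, `r ≥ 3` and `i₁ = i₂ + ⋯ + i_r`, then over any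
finite alphabet, every word of length `2 i₁` satisfying the invariance
conditions `w t = w (t + i_j)` (`0 < t < i_j`, all `j`) contains a square
`v ++ v` with `|v| ∈ {i₁, …, i_r}` (i.e. `minA(s) = ∞`). -/
theorem minA_infinite_of_sum_eq {A : Type*} [Finite A] (r : ℕ) (hr : 3 ≤ r)
    (i : ℕ → ℕ) (hpos : ∀ t, 1 ≤ t → t ≤ r → 1 ≤ i t)
    (hdec : ∀ t, 1 ≤ t → t < r → i (t + 1) < i t)
    (hsum : i 1 = ∑ j ∈ Finset.Icc 2 r, i j)
    (w : ℕ → A)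
    (hinv : ∀ j, 1 ≤ j → j ≤ r → ∀ t, 1 ≤ t → t < i j → w t = w (t + i j)) :
    ∃ j, 1 ≤ j ∧ j ≤ r ∧ ∃ x, 1 ≤ x ∧ x + 2 * i j - 1 ≤ 2 * i 1 ∧
      ∀ t < i j, w (x + t) = w (x + t + i j) := by
  have hmono : ∀ t, 1 ≤ t → t ≤ r → ∀ s, 1 ≤ s → s < t → i t < i s := by
    intro t ht
    induction t, ht using Nat.le_induction with
    | base => intro _ s hs hst; omega
    | succ t ht ih =>
      intro htr s hs hst
      rcases (Nat.lt_succ_iff.1 hst).eq_or_lt with rfl | hst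
      · exact hdec s hs htr
      · exact (hdec t ht htr).trans (ih (by omega) s hs hst)
  have hinj : Set.InjOn i (Finset.Icc 2 r : Finset ℕ) := fun s hs t ht hst => by
    simp only [Finset.coe_Icc, Set.mem_Icc] at hs ht
    rcases lt_trichotomy s t with h | h | h
    · have := hmono t (by omega) ht.2 s (by omega) h; omega
    · exact h
    · have := hmono s (by omega) hs.2 t (by omega) h; omega
  have hmem : ∀ {P : ℕ → Prop}, (∀ j, 1 ≤ j → j ≤ r → P (i j)) →
      ∀ q ∈ (Finset.Icc 1 r).image i, P q := fun h q hq => by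
    obtain ⟨j, hj, rfl⟩ := Finset.mem_image.1 hq
    rw [Finset.mem_Icc] at hj
    exact h j hj.1 hj.2
  obtain ⟨p, hp, q, hq, h⟩ := exists_apply_eq_of_le_sum (w := w) (Q := (Finset.Icc 1 r).image i)
    (hmem hpos) (hmem fun j hj hjr t ht htj => hinv j hj hjr t ht (by omega))
    ⟨i 1, Finset.mem_image_of_mem i (Finset.mem_Icc.2 ⟨le_rfl, by omega⟩),
      (Finset.Icc 2 r).image i,
      Finset.image_subset_image (Finset.Icc_subset_Icc_left (by omega)),
      fun x hx => by
        obtain ⟨j, hj, rfl⟩ := Finset.mem_image.1 hx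
        rw [Finset.mem_Icc] at hj
        exact hmono j (by omega) hj.2 1 le_rfl (by omega),
      by rw [Finset.sum_image hinj, hsum]⟩
  obtain ⟨k, hk, rfl⟩ := Finset.mem_image.1 hp
  obtain ⟨j, hj, rfl⟩ := Finset.mem_image.1 hq
  rw [Finset.mem_Icc] at hk hj
  have hk1 : i k ≤ i 1 := by
    rcases hk.1.eq_or_lt with rfl | h
    · exact le_rfl
    · exact (hmono k hk.1 hk.2 1 le_rfl h).le
  have hj0 := hpos j hj.1 hj.2
  refine ⟨j, hj.1, hj.2, ?_⟩
  rcases h with ⟨hjk, h⟩ | ⟨hjk, h⟩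
  · refine ⟨i k, by omega, by omega, fun t ht => ?_⟩
    have hjt : w (i k + t + i j) = w (t + i j) := by
      rw [hinv k hk.1 hk.2 (t + i j) (by omega) (by omega)]
      congr 1; omega
    rcases Nat.eq_zero_or_pos t with rfl | ht0
    · rw [hjt, add_zero, zero_add, h]
    · rw [hjt, ← hinv j hj.1 hj.2 t ht0 ht, hinv k hk.1 hk.2 t ht0 (by omega), add_comm]
  · refine ⟨1, le_rfl, by omega, fun t ht => ?_⟩
    rcases (Nat.succ_le_of_lt ht).eq_or_lt with htj | htj
    · rw [show 1 + t = i j by omega, h, two_mul]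
    · exact hinv j hj.1 hj.2 (1 + t) (by omega) (by omega)
end

section
/- Let s = (i_r, …, i₂, i₁) satisfy condition D: i₁ < i₂ + ⋯ + i_r, i₁ > i₂ + ⋯ + i_{r−1}, and i_t > i_{t+1} + ⋯ + i_r for all 2 ≤ t ≤ r−2, with i_{r−1} > i_r. Then every word w of length 2i₁ over any alphabet satisfying the invariance conditions w_t = w_{t+i_j} (for 0 < t < i_j, all j ≤ r) contains a square vv with |v| ∈ {i₁,…,i_r}. (minA(s) = ∞.) -/
/-- `m` is positive, smaller than `x`, and a period of the factor of `w` on the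
positions `1, …, x - 1`. -/
def PeriodBelow {A : Type*} (w : ℕ → A) (x m : ℕ) : Prop :=
  0 < m ∧ m < x ∧ ∀ t, 1 ≤ t → t + m < x → w (t + m) = w t

/-- A Euclidean algorithm along a chain of periods ending in `H`: if the prefix of length `H - 1`
occurs in `w` right after position `D`, then the letter at `D` is the letter at an element of the
chain. -/
theorem euclid_of_chain {A : Type*} (w : ℕ → A) (P : A → Prop) (N : ℕ) :
    ∀ (g : ℕ) (L : List ℕ) (H D : ℕ), g + D ≤ N → List.IsChain (PeriodBelow w) (g :: L) →
      (g :: L).getLast? = some H → (∀ m ∈ L, P (w m)) → 0 < H → 0 < D → D + H ≤ g →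
      (∀ t, 1 ≤ t → t < H → w (D + t) = w t) → P (w D) := by
  induction N with
  | zero => intros; omega
  | succ N ih =>
    intro g L H D hN hc hlast hP hH hD hDH hw
    cases L with
    | nil =>
      simp only [List.getLast?_singleton, Option.some.injEq] at hlast
      omega
    | cons m L =>
      rw [List.isChain_cons_cons] at hc
      obtain ⟨⟨hm0, hmg, hper⟩, hc⟩ := hc
      rw [List.getLast?_cons_cons] at hlast
      rcases lt_trichotomy D m with h | h | h
      · by_cases hcross : D + H ≤ m
        · exact ih m L H D (by omega) hc hlast (fun x hx => hP x (List.mem_cons_of_mem _ hx))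
            hH hD hcross hw
        · have hmD : D + (m - D) = m := by omega
          refine ih m (L ++ [m - D]) (m - D) D (by omega) ?_ ?_ ?_ (by omega) hD (by omega) ?_
          · rw [← List.cons_append, List.isChain_append]
            refine ⟨hc, List.isChain_singleton _, ?_⟩
            intro x hx y hy
            rw [hlast] at hx
            simp only [Option.mem_def, Option.some.injEq, List.head?_cons] at hx hy
            subst hx hy
            refine ⟨by omega, by omega, fun t ht htx => ?_⟩
            rw [← hw _ (by omega) htx, ← hper t ht (by omega)]
            congr 1
            omega
          · rw [← List.cons_append, List.getLast?_append]
            simp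
          · intro x hx
            rcases List.mem_append.1 hx with hx | hx
            · exact hP x (List.mem_cons_of_mem _ hx)
            · rw [List.mem_singleton.1 hx, ← hw _ (by omega) (by omega), hmD]
              exact hP m List.mem_cons_self
          · intro t ht htm
            exact hw t ht (by omega)
      · exact h ▸ hP m List.mem_cons_self
      · have key : ∀ t, D + t < g → w (D - m + t) = w (D + t) := by
          intro t ht
          rw [← hper (D - m + t) (by omega) (by omega)]
          congr 1
          omega
        rw [← Nat.add_zero D, ← key 0 (by omega)]
        refine ih g (m :: L) H (D - m) (by omega) ?_ ?_ hP hH (by omega) (by omega) ?_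
        · exact List.isChain_cons_cons.2 ⟨⟨hm0, hmg, hper⟩, hc⟩
        · rw [List.getLast?_cons_cons, hlast]
        · intro t ht htH
          rw [key t (by omega), hw t ht htH]

/-- If the prefix of length `d` occurs in `w` right after position `u`, then any property shared by
the letters at the elements of a chain of periods starting at `d + u` holds at `u`, provided
the prefix agrees with the window after `d` for long enough. -/
theorem apply_of_shift_of_chain {A : Type*} {w : ℕ → A} {P : A → Prop} {d u c H : ℕ} {L : List ℕ}
    (hd : 0 < d) (hu : 0 < u) (hchain : List.IsChain (PeriodBelow w) ((d + u) :: L))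
    (hlast : ((d + u) :: L).getLast? = some H) (hP : ∀ m ∈ (d + u) :: L, P (w m))
    (hH : 0 < H) (hshift : ∀ t, 1 ≤ t → t ≤ d → w (u + t) = w t)
    (hwin : ∀ t, 1 ≤ t → t < H → t < c → w (d + t) = w t) (hc : H ≤ d + c) : P (w u) := by
  by_cases hHd : H ≤ d
  · exact euclid_of_chain w P _ (d + u) L H u le_rfl hchain hlast
      (fun m hm => hP m (List.mem_cons_of_mem _ hm)) hH hu (by omega)
      (fun t h1 h2 => hshift t h1 (by omega))
  · refine euclid_of_chain w P _ (d + u) (L ++ [d]) d u le_rfl ?_ ?_ ?_ hd hu (by omega)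
      (fun t h1 h2 => hshift t h1 (by omega))
    · rw [← List.cons_append, List.isChain_append]
      refine ⟨hchain, List.isChain_singleton _, ?_⟩
      intro x hx y hy
      rw [hlast] at hx
      simp only [Option.mem_def, Option.some.injEq, List.head?_cons] at hx hy
      subst hx hy
      refine ⟨hd, by omega, fun t ht htH => ?_⟩
      rw [Nat.add_comm]
      exact hwin t ht (by omega) (by omega)
    · rw [← List.cons_append, List.getLast?_append]
      simp
    · intro m hm
      rcases List.mem_append.1 hm with hm | hm
      · exact hP m (List.mem_cons_of_mem _ hm)
      · rw [List.mem_singleton.1 hm, ← hshift d hd le_rfl, Nat.add_comm]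
        exact hP _ List.mem_cons_self

theorem sum_Icc_eq_add_sum_Icc_succ (f : ℕ → ℕ) {k r : ℕ} (h : k ≤ r) :
    ∑ j ∈ Finset.Icc k r, f j = f k + ∑ j ∈ Finset.Icc (k + 1) r, f j := by
  rw [← Finset.insert_Icc_succ_left_eq_Icc h, Finset.sum_insert (by simp)]
  simp

/-- For a word invariant under shifts by a superdecreasing sequence, there is a chain of periods
from the last term down to some `H` such that the prefix of length `H - 1` occurs right after
the sum of the sequence. -/
theorem exists_chain_of_superdecreasing {A : Type*} {w : ℕ → A} {i : ℕ → ℕ} {r k : ℕ}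
    (hr : 1 ≤ i r) (hgap : ∀ j, k ≤ j → j < r → ∑ l ∈ Finset.Icc (j + 1) r, i l < i j)
    (hinv : ∀ j, k ≤ j → j ≤ r → ∀ t, 1 ≤ t → t < i j → w t = w (t + i j)) (hk : k ≤ r) :
    ∃ L H, List.IsChain (PeriodBelow w) (i r :: L) ∧ (i r :: L).getLast? = some H ∧
      0 < H ∧ H ≤ i r ∧ (∀ m ∈ L, ∃ j, k ≤ j ∧ j ≤ r ∧ w m = w (i j)) ∧
      (∀ t, 1 ≤ t → t < H → w (∑ j ∈ Finset.Icc k r, i j + t) = w t) ∧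
      (k = r → H = i r) := by
  induction hn : r - k generalizing k with
  | zero =>
    obtain rfl : k = r := by omega
    refine ⟨[], i k, List.isChain_singleton _, by simp, hr, le_rfl, by simp, ?_, fun _ => rfl⟩
    intro t h1 h2
    rw [Finset.Icc_self, Finset.sum_singleton, Nat.add_comm]
    exact (hinv k le_rfl le_rfl t h1 h2).symm
  | succ n ih =>
    obtain ⟨L, H, hchain, hlast, hH, hHr, hL, hwin, -⟩ :=
      ih (k := k + 1) (fun j h => hgap j (by omega)) (fun j h => hinv j (by omega)) (by omega)
        (by omega)
    have hg := hgap k le_rfl (by omega)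
    have hsum := sum_Icc_eq_add_sum_Icc_succ i hk
    have hT : i r ≤ ∑ j ∈ Finset.Icc (k + 1) r, i j :=
      Finset.single_le_sum (fun _ _ => Nat.zero_le _) (Finset.mem_Icc.2 ⟨by omega, le_rfl⟩)
    rw [hsum]
    generalize ∑ j ∈ Finset.Icc (k + 1) r, i j = T at *
    have hshift : ∀ t, T + t < i k → w (i k + T + t) = w (T + t) := by
      intro t ht
      rw [hinv k le_rfl hk (T + t) (by omega) ht]
      congr 1
      omega
    have hL' : ∀ m ∈ L, ∃ j, k ≤ j ∧ j ≤ r ∧ w m = w (i j) := fun m hm =>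
      let ⟨j, h1, h2⟩ := hL m hm
      ⟨j, by omega, h2⟩
    by_cases hc : H ≤ i k - T
    · refine ⟨L, H, hchain, hlast, hH, hHr, hL', ?_, by omega⟩
      intro t h1 h2
      rw [hshift t (by omega), hwin t h1 h2]
    · have hgT : T + (i k - T) = i k := by omega
      refine ⟨L ++ [i k - T], i k - T, ?_, ?_, by omega, by omega, ?_, ?_, by omega⟩
      · rw [← List.cons_append, List.isChain_append]
        refine ⟨hchain, List.isChain_singleton _, ?_⟩
        intro x hx y hy
        rw [hlast] at hx
        simp only [Option.mem_def, Option.some.injEq, List.head?_cons] at hx hy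
        subst hx hy
        refine ⟨by omega, by omega, fun t ht htH => ?_⟩
        rw [← hwin _ (by omega) htH, hinv k le_rfl hk t ht (by omega)]
        congr 1
        omega
      · rw [← List.cons_append, List.getLast?_append]
        simp
      · intro m hm
        rcases List.mem_append.1 hm with hm | hm
        · exact hL' m hm
        · rw [List.mem_singleton.1 hm]
          refine ⟨k, le_rfl, hk, ?_⟩
          rw [← hwin _ (by omega) (by omega), hgT]
      · intro t h1 h2
        rw [hshift t (by omega), hwin t h1 (by omega)]

/-- For a word invariant under shifts by a superdecreasing sequence, the prefix whose length is
the last term occurs right after the sum of the other terms. -/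
theorem apply_sum_add_of_superdecreasing {A : Type*} {w : ℕ → A} {i : ℕ → ℕ} {n k : ℕ}
    (hgap : ∀ j, k ≤ j → j ≤ n → ∑ l ∈ Finset.Icc (j + 1) (n + 1), i l < i j)
    (hinv : ∀ j, k ≤ j → j ≤ n → ∀ t, 1 ≤ t → t < i j → w t = w (t + i j)) {t : ℕ}
    (ht : 1 ≤ t) (htn : t ≤ i (n + 1)) : w (∑ j ∈ Finset.Icc k n, i j + t) = w t := by
  induction hm : n + 1 - k generalizing k with
  | zero => simp [Finset.Icc_eq_empty (show ¬k ≤ n by omega)]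
  | succ m ih =>
    rw [sum_Icc_eq_add_sum_Icc_succ i (show k ≤ n by omega)]
    have hg := hgap k le_rfl (by omega)
    rw [Finset.sum_Icc_succ_top (by omega)] at hg
    rw [← ih (k := k + 1) (fun j h => hgap j (by omega)) (fun j h => hinv j (by omega)) (by omega),
      hinv k le_rfl (by omega) (∑ j ∈ Finset.Icc (k + 1) n, i j + t) (by omega) (by omega)]
    congr 1
    omega

/-- If the prefixes of lengths `p - 1` and `q - 1` are repeated after positions `p` and `q`,
where `2 * q ≤ p`, and `w` carries the same letter at `p` and `q`, then a `q`-square starts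
at `p`. -/
theorem square_of_apply_eq {A : Type*} {w : ℕ → A} {p q : ℕ} (hpq : 2 * q ≤ p)
    (hp : ∀ t, 1 ≤ t → t < p → w t = w (t + p)) (hq : ∀ t, 1 ≤ t → t < q → w t = w (t + q))
    (h : w p = w q) : ∀ t < q, w (p + t) = w (p + t + q) := by
  intro t ht
  rw [show p + t + q = t + q + p by omega, ← hp (t + q) (by omega) (by omega)]
  rcases Nat.eq_zero_or_pos t with rfl | ht0
  · simpa using h
  · rw [Nat.add_comm p, ← hp t ht0 (by omega), hq t ht0 ht]

/-- If `i₁ > i₂ > ⋯ > i_r ≥ 1` satisfies condition D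
(`i₁ < i₂ + ⋯ + i_r`, `i₁ > i₂ + ⋯ + i_{r−1}`,
`i_t > i_{t+1} + ⋯ + i_r` for `2 ≤ t ≤ r − 2`, and `i_{r−1} > i_r`),
then every word of length `2 i₁` over any alphabet satisfying the invariance
conditions `w t = w (t + i_j)` (`0 < t < i_j`, all `j`) contains a square
`v ++ v` with `|v| ∈ {i₁, …, i_r}` (i.e. `minA(s) = ∞`). -/
theorem minA_infinite_of_condition_D {A : Type*} (r : ℕ)
    (i : ℕ → ℕ) (hpos : ∀ t, 1 ≤ t → t ≤ r → 1 ≤ i t)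
    (hdec : ∀ t, 1 ≤ t → t < r → i (t + 1) < i t)
    (hD1 : i 1 < ∑ j ∈ Finset.Icc 2 r, i j)
    (hD2 : ∑ j ∈ Finset.Icc 2 (r - 1), i j < i 1)
    (hD3 : ∀ t, 2 ≤ t → t ≤ r - 2 → ∑ j ∈ Finset.Icc (t + 1) r, i j < i t)
    (w : ℕ → A)
    (hinv : ∀ j, 1 ≤ j → j ≤ r → ∀ t, 1 ≤ t → t < i j → w t = w (t + i j)) :
    ∃ j, 1 ≤ j ∧ j ≤ r ∧ ∃ x, 1 ≤ x ∧ x + 2 * i j - 1 ≤ 2 * i 1 ∧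
      ∀ t < i j, w (x + t) = w (x + t + i j) := by
  have hr : 3 ≤ r := by
    by_contra hlt
    rcases (show r = 0 ∨ r = 1 ∨ r = 2 by omega) with rfl | rfl | rfl
    · simp at hD1
    · simp at hD1
    · have := hdec 1 le_rfl (by norm_num)
      norm_num at hD1 this
      omega
  obtain ⟨n, rfl⟩ : ∃ n, r = n + 1 := ⟨r - 1, by omega⟩
  rw [Nat.add_sub_cancel] at hD2
  have hgap : ∀ j, 2 ≤ j → j < n + 1 → ∑ l ∈ Finset.Icc (j + 1) (n + 1), i l < i j := by
    intro j h1 h2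
    rcases Nat.lt_or_ge j n with h | h
    · exact hD3 j h1 (by omega)
    · obtain rfl : j = n := by omega
      simpa using hdec j (by omega) h2
  obtain ⟨L, H, hchain, hlast, hH, hHr, hL, hwin, hH3⟩ :=
    exists_chain_of_superdecreasing (k := 3) (hpos (n + 1) (by omega) le_rfl)
      (fun j h => hgap j (by omega)) (fun j h => hinv j (by omega)) hr
  have hP : ∀ t, 1 ≤ t → t ≤ i (n + 1) → w (∑ j ∈ Finset.Icc 2 n, i j + t) = w t :=
    fun t => apply_sum_add_of_superdecreasing (fun j h h' => hgap j h (by omega))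
      (fun j h h' => hinv j (by omega) (by omega))
  have hT2 := sum_Icc_eq_add_sum_Icc_succ i (show 2 ≤ n + 1 by omega)
  have hTP := Finset.sum_Icc_succ_top (show 2 ≤ n + 1 by omega) i
  have hg2 := hgap 2 le_rfl (by omega)
  have hT3 : i (n + 1) ≤ ∑ j ∈ Finset.Icc 3 (n + 1), i j :=
    Finset.single_le_sum (fun _ _ => Nat.zero_le _) (Finset.mem_Icc.2 ⟨by omega, le_rfl⟩)
  have hT3' : ∀ k, 3 ≤ k → k ≤ n → i k + i (n + 1) ≤ ∑ j ∈ Finset.Icc 3 (n + 1), i j := by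
    intro k h1 h2
    rw [Finset.sum_Icc_succ_top (by omega)]
    exact Nat.add_le_add_right
      (Finset.single_le_sum (fun _ _ => Nat.zero_le _) (Finset.mem_Icc.2 ⟨h1, h2⟩)) _
  have h21 := hdec 1 le_rfl (by omega)
  rw [hTP] at hD1 hT2
  norm_num only at hT2 hg2 h21
  have hr3 : n = 2 → ∑ j ∈ Finset.Icc 3 (n + 1), i j = i 3 := by rintro rfl; simp
  generalize ∑ j ∈ Finset.Icc 3 (n + 1), i j = T at *
  generalize ∑ j ∈ Finset.Icc 2 n, i j = S at *
  obtain ⟨d, hd⟩ : ∃ d, d + i 1 = S + i (n + 1) := ⟨S + i (n + 1) - i 1, by omega⟩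
  obtain ⟨u, hu⟩ : ∃ u, i 1 = S + u := ⟨i 1 - S, by omega⟩
  obtain ⟨c, hc⟩ : ∃ c, i 2 = T + c := ⟨i 2 - T, by omega⟩
  have hdu : i (n + 1) = d + u := by omega
  have hwu : w (i 1) = w u := by rw [hu, hP u (by omega) (by omega)]
  have hshift : ∀ t, 1 ≤ t → t ≤ d → w (u + t) = w t := by
    intro t h1 h2
    rw [← hP (u + t) (by omega) (by omega), ← Nat.add_assoc, ← hu, Nat.add_comm]
    exact (hinv 1 le_rfl (by omega) t h1 (by omega)).symm
  have hwind : ∀ t, 1 ≤ t → t < H → t < c → w (d + t) = w t := by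
    intro t h1 h2 h3
    rw [← hwin t h1 h2, hinv 1 le_rfl (by omega) (d + t) (by omega) (by omega),
      hinv 2 (by omega) (by omega) (T + t) (by omega) (by omega)]
    congr 1
    omega
  have hwc : c < H → w c = w (i 2) := fun h => by rw [← hwin c (by omega) h, hc]
  have hper : ∀ t, 1 ≤ t → t + c < H → w (t + c) = w t := by
    intro t h1 h2
    rw [← hwin _ (by omega) h2, hinv 2 (by omega) (by omega) t h1 (by omega)]
    congr 1
    omega
  have hfar : H ≤ d + c → ∃ k, 3 ≤ k ∧ k ≤ n + 1 ∧ w (i 1) = w (i k) := by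
    intro h
    rw [hwu]
    rw [hdu] at hchain hlast
    refine apply_of_shift_of_chain (P := fun x => ∃ k, 3 ≤ k ∧ k ≤ n + 1 ∧ x = w (i k)) (by omega)
      (by omega) hchain hlast ?_ hH hshift hwind h
    intro m hm
    rcases List.mem_cons.1 hm with rfl | hm
    · exact ⟨n + 1, hr, le_rfl, by rw [hdu]⟩
    · exact hL m hm
  have hnear : d + c < H → w d = w (i 2) := by
    intro h
    rw [← hwc (by omega)]
    refine euclid_of_chain w (· = w c) _ H [c] c d le_rfl ?_ (by simp) (by simp) (by omega)
      (by omega) h.le (fun t h1 h2 => hwind t h1 (by omega) h2)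
    exact List.isChain_cons_cons.2 ⟨⟨by omega, by omega, hper⟩, List.isChain_singleton _⟩
  by_cases hlarge : 3 ≤ n ∨ 2 * i (n + 1) ≤ i 2
  · rcases Nat.lt_or_ge (d + c) H with h | h
    · have h2 : 2 * i (n + 1) ≤ i 2 := by
        rcases hlarge with hn | hn
        · have := hT3' n hn le_rfl
          have := hdec n (by omega) (by omega)
          omega
        · exact hn
      refine ⟨n + 1, by omega, le_rfl, i 2, by omega, by omega,
        square_of_apply_eq h2 (hinv 2 (by omega) (by omega)) (hinv _ (by omega) le_rfl) ?_⟩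
      rw [← hnear h, hdu, Nat.add_comm, hshift d (by omega) le_rfl]
    · obtain ⟨k, hk3, hkn, hk⟩ := hfar h
      have h2 : 2 * i k ≤ i 1 := by
        rcases Nat.lt_or_ge k (n + 1) with hlt | hge
        · have := hT3' k hk3 (by omega)
          omega
        · obtain rfl : k = n + 1 := by omega
          rcases hlarge with hn | hn
          · have := hT3' n hn le_rfl
            have := hdec n (by omega) (by omega)
            omega
          · omega
      exact ⟨k, by omega, hkn, i 1, by omega, by omega,
        square_of_apply_eq h2 (hinv 1 le_rfl (by omega)) (hinv k (by omega) hkn) hk⟩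
  · obtain rfl : n = 2 := by omega
    obtain rfl := hH3 rfl
    obtain rfl := hr3 rfl
    norm_num only at *
    refine ⟨2, by omega, by omega, 1, le_rfl, by omega, fun t ht => ?_⟩
    rcases Nat.lt_or_ge (1 + t) (i 2) with h | h
    · exact hinv 2 (by omega) (by omega) _ (by omega) h
    rw [show 1 + t = i 2 by omega, ← hwc (by omega),
      show i 2 + i 2 = d + c + i 1 by omega, ← hinv 1 le_rfl (by omega) _ (by omega) (by omega)]
    rcases lt_trichotomy c u with h | rfl | h
    · rw [hper d (by omega) (by omega), hnear (by omega), hwc (by omega)]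
    · obtain ⟨k, h3, h3', hk⟩ := hfar (by omega)
      obtain rfl : k = 3 := by omega
      rw [← hdu, ← hk, hwu]
    · obtain ⟨s, rfl⟩ : ∃ s, c = u + s := ⟨c - u, by omega⟩
      rw [← Nat.add_assoc, ← hdu, hshift s (by omega) (by omega), Nat.add_comm,
        hinv 3 (by omega) (by omega) s (by omega) (by omega)]
end
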